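/- arXiv:2309.05673 — 9 statements merged into one kernel-verified Lean document; each statement's English description precedes it below -/
import Mathlib

section
/- As a vector space, N(ĥ_ℤ) is isomorphic to T(ĥ_ℤ⁻) ⊗ T(ĥ_ℤ⁺) ⊗ T(h⊗t⁰) ⊗ T(ℂk); more precisely, the ℂ-linear map T(ĥ_ℤ⁻) ⊗ T(ĥ_ℤ⁺) ⊗ T(h⊗t⁰) ⊗ T(ℂk) → N(ĥ_ℤ) that sends u⁻ ⊗ u⁺ ⊗ u⁰ ⊗ uᵏ to the image in the quotient N(ĥ_ℤ) of the product u⁻·u⁺·u⁰·uᵏ (computed in T(ĥ_ℤ) via the inclusions of the four subspaces into ĥ_ℤ) is a linear isomorphism. -/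
open TensorProduct

noncomputable section

/-- `h = ℂ^{2M}`. -/
abbrev hSp (M : ℕ) : Type := Fin (2 * M) → ℂ

/-- The affinization `ĥ_ℤ = (h ⊗ ℂ[t,t⁻¹]) ⊕ ℂk` as a vector space. -/
abbrev Hhat (M : ℕ) : Type := (TensorProduct ℂ (hSp M) (LaurentPolynomial ℂ)) × ℂ

/-- The element `a ⊗ tᵐ` of `ĥ_ℤ`. -/
def mode {M : ℕ} (a : hSp M) (m : ℤ) : Hhat M := (a ⊗ₜ[ℂ] LaurentPolynomial.T m, 0)

/-- The central element `k` of `ĥ_ℤ`. -/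
def kk (M : ℕ) : Hhat M := (0, 1)

/-- The tensor algebra `T(ĥ_ℤ)`. -/
abbrev TA (M : ℕ) : Type := TensorAlgebra ℂ (Hhat M)

/-- The canonical inclusion `ĥ_ℤ → T(ĥ_ℤ)`. -/
def ιT {M : ℕ} (x : Hhat M) : TA M := TensorAlgebra.ι ℂ x

/-- The set of generators of the two-sided ideal `J`:
`(a⊗tᵐ)(b⊗tⁿ) + (b⊗tⁿ)(a⊗tᵐ) − m(a,b)δ_{m+n,0}k` for `m > 0 > n`;
`(a⊗tᵖ)(b⊗t⁰) + (b⊗t⁰)(a⊗tᵖ)` for `p ≠ 0`; and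
`(a⊗t^q)k − k(a⊗t^q)`. -/
def genSet (M : ℕ) (B : hSp M →ₗ[ℂ] hSp M →ₗ[ℂ] ℂ) : Set (TA M) :=
  {x | ∃ (a b : hSp M) (m n : ℤ), 0 < m ∧ n < 0 ∧
      x = ιT (mode a m) * ιT (mode b n) + ιT (mode b n) * ιT (mode a m)
          - (if m + n = 0 then (m : ℂ) * B a b else 0) • ιT (kk M)} ∪
  {x | ∃ (a b : hSp M) (p : ℤ), p ≠ 0 ∧
      x = ιT (mode a p) * ιT (mode b 0) + ιT (mode b 0) * ιT (mode a p)} ∪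
  {x | ∃ (a : hSp M) (q : ℤ),
      x = ιT (mode a q) * ιT (kk M) - ιT (kk M) * ιT (mode a q)}

/-- The relation generating the quotient `N(ĥ_ℤ) = T(ĥ_ℤ)/J`. -/
def genRel (M : ℕ) (B : hSp M →ₗ[ℂ] hSp M →ₗ[ℂ] ℂ) : TA M → TA M → Prop :=
  fun x y => x ∈ genSet M B ∧ y = 0

/-- `N(ĥ_ℤ)`, the quotient of `T(ĥ_ℤ)` by the two-sided ideal `J`. -/
abbrev NA (M : ℕ) (B : hSp M →ₗ[ℂ] hSp M →ₗ[ℂ] ℂ) : Type := RingQuot (genRel M B)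

/-- The quotient map `T(ĥ_ℤ) → N(ĥ_ℤ)`. -/
def mkN (M : ℕ) (B : hSp M →ₗ[ℂ] hSp M →ₗ[ℂ] ℂ) : TA M →ₐ[ℂ] NA M B :=
  RingQuot.mkAlgHom ℂ (genRel M B)

/-- `ĥ_ℤ⁻ = h ⊗ t⁻¹ℂ[t⁻¹]`, the span of the `a ⊗ tᵐ` with `m < 0`. -/
def negPart (M : ℕ) : Submodule ℂ (Hhat M) :=
  Submodule.span ℂ {x | ∃ (a : hSp M) (m : ℤ), m < 0 ∧ x = mode a m}

/-- `ĥ_ℤ⁺ = h ⊗ tℂ[t]`, the span of the `a ⊗ tᵐ` with `m > 0`. -/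
def posPart (M : ℕ) : Submodule ℂ (Hhat M) :=
  Submodule.span ℂ {x | ∃ (a : hSp M) (m : ℤ), 0 < m ∧ x = mode a m}

/-- `h ⊗ t⁰`, the span of the `a ⊗ t⁰`. -/
def zeroPart (M : ℕ) : Submodule ℂ (Hhat M) :=
  Submodule.span ℂ {x | ∃ a : hSp M, x = mode a 0}

/-- `ℂk`. -/
def kPart (M : ℕ) : Submodule ℂ (Hhat M) :=
  Submodule.span ℂ {kk M}

/-- For a subspace `p ⊆ ĥ_ℤ`, the algebra map `T(p) → N(ĥ_ℤ)` induced by the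
inclusion `p ⊆ ĥ_ℤ ⊆ T(ĥ_ℤ)` followed by the quotient map. -/
def partMap (M : ℕ) (B : hSp M →ₗ[ℂ] hSp M →ₗ[ℂ] ℂ) (p : Submodule ℂ (Hhat M)) :
    TensorAlgebra ℂ p →ₐ[ℂ] NA M B :=
  TensorAlgebra.lift ℂ ((mkN M B).toLinearMap ∘ₗ (TensorAlgebra.ι ℂ) ∘ₗ p.subtype)

namespace NAProof

open TensorProduct

section generic

variable {A P Z K : Type} [AddCommGroup A] [Module ℂ A] [AddCommGroup P] [Module ℂ P]
  [AddCommGroup Z] [Module ℂ Z] [AddCommGroup K] [Module ℂ K]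

/-- Left induction on a tensor algebra. -/
theorem left_induction {Q : TensorAlgebra ℂ A → Prop} (h1 : Q 1)
    (hadd : ∀ x y, Q x → Q y → Q (x + y)) (hsmul : ∀ (c : ℂ) x, Q x → Q (c • x))
    (hmul : ∀ v x, Q x → Q (TensorAlgebra.ι ℂ v * x)) (x : TensorAlgebra ℂ A) : Q x := by
  have key : ∀ x : TensorAlgebra ℂ A, ∀ y, Q y → Q (x * y) := by
    intro x
    induction x using TensorAlgebra.induction with
    | algebraMap r =>
      intro y hy
      rw [← Algebra.smul_def]
      exact hsmul r y hy
    | ι v => exact fun y hy => hmul v y hy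
    | mul a b ha hb =>
      intro y hy
      rw [mul_assoc]
      exact ha _ (hb _ hy)
    | add a b ha hb =>
      intro y hy
      rw [add_mul]
      exact hadd _ _ (ha _ hy) (hb _ hy)
  simpa using key x 1 h1

/-- Grade involution. -/
def sgn : TensorAlgebra ℂ A →ₐ[ℂ] TensorAlgebra ℂ A :=
  TensorAlgebra.lift ℂ (-TensorAlgebra.ι ℂ)

theorem sgn_ι (v : A) : sgn (TensorAlgebra.ι ℂ v) = -TensorAlgebra.ι ℂ v := by
  simp [sgn]

/-- One step of the contraction. -/
def stepD : A →ₗ[ℂ] Module.End ℂ (TensorAlgebra ℂ A × (Module.Dual ℂ A →ₗ[ℂ] TensorAlgebra ℂ A)) :=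
  LinearMap.mk₂ ℂ
    (fun n uf => (TensorAlgebra.ι ℂ n * uf.1,
      (Module.Dual.eval ℂ A n).smulRight uf.1
        - (LinearMap.mulLeft ℂ (TensorAlgebra.ι ℂ n)) ∘ₗ uf.2))
    (by
      intro m n uf
      ext φ <;> simp [add_mul, add_smul]
      abel)
    (by
      intro c n uf
      ext φ <;> simp [smul_sub, mul_smul])
    (by
      intro n uf vg
      ext φ <;> simp [mul_add]
      abel)
    (by
      intro c n uf
      ext φ
      · simp
      · simp [smul_sub, smul_comm c])

/-- Contraction. -/
def pairD : TensorAlgebra ℂ A →ₗ[ℂ]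
    (TensorAlgebra ℂ A × (Module.Dual ℂ A →ₗ[ℂ] TensorAlgebra ℂ A)) :=
  (LinearMap.applyₗ ((1, 0) : TensorAlgebra ℂ A × (Module.Dual ℂ A →ₗ[ℂ] TensorAlgebra ℂ A))) ∘ₗ
    (TensorAlgebra.lift ℂ (stepD (A := A))).toLinearMap

theorem pairD_ι_mul (v : A) (x : TensorAlgebra ℂ A) :
    pairD (TensorAlgebra.ι ℂ v * x) = stepD v (pairD x) := by
  simp [pairD]

theorem pairD_fst (x : TensorAlgebra ℂ A) : (pairD x).1 = x := by
  induction x using left_induction with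
  | h1 => simp [pairD]
  | hadd x y hx hy => simp [hx, hy]
  | hsmul c x hx => simp [hx]
  | hmul v x hx => rw [pairD_ι_mul]; simp [stepD, hx]

/-- Contraction by a linear form, an antiderivation. -/
def DD : TensorAlgebra ℂ A →ₗ[ℂ] Module.Dual ℂ A →ₗ[ℂ] TensorAlgebra ℂ A :=
  LinearMap.snd ℂ _ _ ∘ₗ pairD

theorem DD_one (φ : Module.Dual ℂ A) : DD (1 : TensorAlgebra ℂ A) φ = 0 := by
  simp [DD, pairD]

theorem DD_ι_mul (φ : Module.Dual ℂ A) (v : A) (x : TensorAlgebra ℂ A) :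
    DD (TensorAlgebra.ι ℂ v * x) φ = φ v • x - TensorAlgebra.ι ℂ v * DD x φ := by
  simp [DD, pairD_ι_mul, stepD, pairD_fst]

theorem DD_sgn (φ : Module.Dual ℂ A) (x : TensorAlgebra ℂ A) :
    DD (sgn x) φ = - sgn (DD x φ) := by
  induction x using left_induction with
  | h1 => simp [DD_one]
  | hadd x y hx hy => simp [hx, hy]; abel
  | hsmul c x hx => simp [hx]
  | hmul v x hx =>
    simp [DD_ι_mul, sgn_ι, hx]

variable (A P Z K) in
/-- The model space. -/
abbrev VV : Type := TensorAlgebra ℂ A ⊗[ℂ] (TensorAlgebra ℂ P ⊗[ℂ]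
          (TensorAlgebra ℂ Z ⊗[ℂ] TensorAlgebra ℂ K))

/-- left multiplication by a generator -/
def mulι : A →ₗ[ℂ] Module.End ℂ (TensorAlgebra ℂ A) :=
  LinearMap.mul ℂ (TensorAlgebra ℂ A) ∘ₗ TensorAlgebra.ι ℂ

@[simp] theorem mulι_apply (v : A) (x : TensorAlgebra ℂ A) :
    mulι v x = TensorAlgebra.ι ℂ v * x := rfl

def opN : A →ₗ[ℂ] Module.End ℂ (VV A P Z K) :=
  LinearMap.rTensorHom _ ∘ₗ mulι

def opK : K →ₗ[ℂ] Module.End ℂ (VV A P Z K) :=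
  LinearMap.lTensorHom _ ∘ₗ LinearMap.lTensorHom _ ∘ₗ LinearMap.lTensorHom _ ∘ₗ mulι

def opZ : Z →ₗ[ℂ] Module.End ℂ (VV A P Z K) :=
  TensorProduct.mapBilinear (RingHom.id ℂ) _ _ _ _ sgn.toLinearMap ∘ₗ
    TensorProduct.mapBilinear (RingHom.id ℂ) _ _ _ _ sgn.toLinearMap ∘ₗ
      LinearMap.rTensorHom _ ∘ₗ mulι

def opP1 : P →ₗ[ℂ] Module.End ℂ (VV A P Z K) :=
  TensorProduct.mapBilinear (RingHom.id ℂ) _ _ _ _ sgn.toLinearMap ∘ₗ LinearMap.rTensorHom _ ∘ₗ mulι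

def opP2 (k : K) : Module.Dual ℂ A →ₗ[ℂ] Module.End ℂ (VV A P Z K) :=
  (TensorProduct.mapBilinear (RingHom.id ℂ) _ _ _ _).flip
    (LinearMap.lTensor _ (LinearMap.lTensor _ (mulι k))) ∘ₗ DD.flip

variable (w : TensorAlgebra ℂ A) (x : TensorAlgebra ℂ P) (y : TensorAlgebra ℂ Z)
  (z : TensorAlgebra ℂ K)

@[simp] theorem opN_apply (n : A) : opN n (w ⊗ₜ[ℂ] (x ⊗ₜ[ℂ] (y ⊗ₜ[ℂ] z))) =
    (TensorAlgebra.ι ℂ n * w) ⊗ₜ[ℂ] (x ⊗ₜ[ℂ] (y ⊗ₜ[ℂ] z)) := rfl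

@[simp] theorem opK_apply (k : K) : opK k (w ⊗ₜ[ℂ] (x ⊗ₜ[ℂ] (y ⊗ₜ[ℂ] z))) =
    w ⊗ₜ[ℂ] (x ⊗ₜ[ℂ] (y ⊗ₜ[ℂ] (TensorAlgebra.ι ℂ k * z))) := rfl

@[simp] theorem opZ_apply (b : Z) : opZ b (w ⊗ₜ[ℂ] (x ⊗ₜ[ℂ] (y ⊗ₜ[ℂ] z))) =
    sgn w ⊗ₜ[ℂ] (sgn x ⊗ₜ[ℂ] ((TensorAlgebra.ι ℂ b * y) ⊗ₜ[ℂ] z)) := rfl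

@[simp] theorem opP1_apply (a : P) : opP1 a (w ⊗ₜ[ℂ] (x ⊗ₜ[ℂ] (y ⊗ₜ[ℂ] z))) =
    sgn w ⊗ₜ[ℂ] ((TensorAlgebra.ι ℂ a * x) ⊗ₜ[ℂ] (y ⊗ₜ[ℂ] z)) := rfl

@[simp] theorem opP2_apply (k : K) (φ : Module.Dual ℂ A) :
    opP2 k φ (w ⊗ₜ[ℂ] (x ⊗ₜ[ℂ] (y ⊗ₜ[ℂ] z))) =
    DD w φ ⊗ₜ[ℂ] (x ⊗ₜ[ℂ] (y ⊗ₜ[ℂ] (TensorAlgebra.ι ℂ k * z))) := rfl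

theorem VV_ext {X : Type} [AddCommGroup X] [Module ℂ X] {f g : VV A P Z K →ₗ[ℂ] X}
    (h : ∀ w x y z, f (w ⊗ₜ[ℂ] (x ⊗ₜ[ℂ] (y ⊗ₜ[ℂ] z))) = g (w ⊗ₜ[ℂ] (x ⊗ₜ[ℂ] (y ⊗ₜ[ℂ] z)))) :
    f = g := by
  refine TensorProduct.ext' fun w u => ?_
  induction u using TensorProduct.induction_on with
  | zero => simp
  | add u v hu hv => simp [TensorProduct.tmul_add, hu, hv]
  | tmul x u =>
    induction u using TensorProduct.induction_on with
    | zero => simp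
    | add u v hu hv => simp only [TensorProduct.tmul_add, map_add, hu, hv]
    | tmul y z => exact h w x y z

theorem rel_PN (a : P) (φ : Module.Dual ℂ A) (k : K) (n : A) :
    (opP1 a + opP2 k φ) * opN n + opN n * (opP1 a + opP2 k φ)
      = (φ n • opK k : Module.End ℂ (VV A P Z K)) := by
  refine VV_ext fun w x y z => ?_
  simp [DD_ι_mul, sgn_ι, TensorProduct.sub_tmul, TensorProduct.neg_tmul, TensorProduct.smul_tmul']
  abel

theorem rel_PZ (a : P) (φ : Module.Dual ℂ A) (k : K) (b : Z) :
    (opP1 a + opP2 k φ) * opZ b + opZ b * (opP1 a + opP2 k φ)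
      = (0 : Module.End ℂ (VV A P Z K)) := by
  refine VV_ext fun w x y z => ?_
  simp [DD_sgn, sgn_ι, TensorProduct.neg_tmul, TensorProduct.tmul_neg]
  abel

theorem rel_NZ (n : A) (b : Z) :
    opN n * opZ b + opZ b * opN n = (0 : Module.End ℂ (VV A P Z K)) := by
  refine VV_ext fun w x y z => ?_
  simp [sgn_ι, TensorProduct.neg_tmul]

theorem rel_PK (a : P) (φ : Module.Dual ℂ A) (k : K) :
    (opP1 a + opP2 k φ) * opK k - opK k * (opP1 a + opP2 k φ)
      = (0 : Module.End ℂ (VV A P Z K)) := by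
  refine VV_ext fun w x y z => ?_
  simp

theorem rel_NK (n : A) (k : K) :
    opN n * opK k - opK k * opN n = (0 : Module.End ℂ (VV A P Z K)) := by
  refine VV_ext fun w x y z => ?_
  simp

theorem rel_ZK (b : Z) (k : K) :
    opZ b * opK k - opK k * opZ b = (0 : Module.End ℂ (VV A P Z K)) := by
  refine VV_ext fun w x y z => ?_
  simp


/-! ### Commutation in an algebra -/

variable {N : Type} [Semiring N] [Algebra ℂ N]

theorem lift_ι_mul (f : A →ₗ[ℂ] N) (v : A) (x : TensorAlgebra ℂ A) :
    TensorAlgebra.lift ℂ f (TensorAlgebra.ι ℂ v * x) = f v * TensorAlgebra.lift ℂ f x := by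
  rw [map_mul, TensorAlgebra.lift_ι_apply]

theorem lift_commute (f : A →ₗ[ℂ] N) (c : N) (h : ∀ v, c * f v = f v * c)
    (w : TensorAlgebra ℂ A) :
    c * TensorAlgebra.lift ℂ f w = TensorAlgebra.lift ℂ f w * c := by
  induction w using left_induction with
  | h1 => simp
  | hadd x y hx hy => simp [mul_add, add_mul, hx, hy]
  | hsmul r x hx => simp [hx]
  | hmul v x hx => rw [lift_ι_mul, ← mul_assoc, h v, mul_assoc, hx, mul_assoc]

theorem lift_neg_ι_mul (f : A →ₗ[ℂ] N) (v : A) (x : TensorAlgebra ℂ A) :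
    TensorAlgebra.lift ℂ f (sgn (TensorAlgebra.ι ℂ v * x)) =
      (-1 : ℂ) • (f v * TensorAlgebra.lift ℂ f (sgn x)) := by
  rw [map_mul, sgn_ι, neg_mul, ← neg_one_smul ℂ, map_smul, lift_ι_mul]

theorem lift_anti (f : A →ₗ[ℂ] N) (c : N) (h : ∀ v, c * f v = (-1 : ℂ) • (f v * c))
    (w : TensorAlgebra ℂ A) :
    c * TensorAlgebra.lift ℂ f w = TensorAlgebra.lift ℂ f (sgn w) * c := by
  induction w using left_induction with
  | h1 => simp
  | hadd x y hx hy => simp only [map_add, mul_add, add_mul, hx, hy]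
  | hsmul r x hx => simp only [map_smul, mul_smul_comm, smul_mul_assoc, hx]
  | hmul v x hx =>
    rw [lift_ι_mul, lift_neg_ι_mul, ← mul_assoc, h v, smul_mul_assoc, smul_mul_assoc, mul_assoc,
      hx, mul_assoc]

theorem lift_PN (f : A →ₗ[ℂ] N) (c k : N) (φ : Module.Dual ℂ A)
    (hk : ∀ v, k * f v = f v * k)
    (h : ∀ v, c * f v = (-1 : ℂ) • (f v * c) + φ v • k)
    (w : TensorAlgebra ℂ A) :
    c * TensorAlgebra.lift ℂ f w =
      TensorAlgebra.lift ℂ f (sgn w) * c + TensorAlgebra.lift ℂ f (DD w φ) * k := by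
  induction w using left_induction with
  | h1 => simp [DD_one]
  | hadd x y hx hy =>
    simp only [map_add, LinearMap.add_apply, mul_add, add_mul, hx, hy]
    abel
  | hsmul r x hx =>
    simp only [map_smul, LinearMap.smul_apply, mul_smul_comm, smul_mul_assoc, hx, smul_add]
  | hmul v x hx =>
    rw [lift_ι_mul, lift_neg_ι_mul, DD_ι_mul, sub_eq_add_neg,
      ← neg_one_smul ℂ (TensorAlgebra.ι ℂ v * DD x φ), map_add, map_smul,
      map_smul, lift_ι_mul, ← mul_assoc, h v, add_mul, smul_mul_assoc, smul_mul_assoc, mul_assoc,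
      hx, lift_commute f k hk, add_mul, smul_mul_assoc, smul_mul_assoc, smul_mul_assoc, mul_add,
      smul_add, mul_assoc, mul_assoc]
    abel

theorem swap_aux {R : Type} [Semigroup R] {a b a' b' : R} (h : a * b = b' * a') (c : R) :
    a * (b * c) = b' * (a' * c) := by
  rw [← mul_assoc, h, mul_assoc]

variable {H : Type} [AddCommGroup H] [Module ℂ H]

/-- The defining relations. -/
structure Rels (jA : A →ₗ[ℂ] H) (jP : P →ₗ[ℂ] H) (jZ : Z →ₗ[ℂ] H) (jK : K →ₗ[ℂ] H)
    (φ : P →ₗ[ℂ] Module.Dual ℂ A) (k0 : K) {E : Type} [Semiring E] [Algebra ℂ E]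
    (F : H →ₗ[ℂ] E) : Prop where
  PN : ∀ a n, F (jP a) * F (jA n) + F (jA n) * F (jP a) = φ a n • F (jK k0)
  NZ : ∀ n b, F (jA n) * F (jZ b) + F (jZ b) * F (jA n) = 0
  PZ : ∀ a b, F (jP a) * F (jZ b) + F (jZ b) * F (jP a) = 0
  NK : ∀ n, F (jA n) * F (jK k0) = F (jK k0) * F (jA n)
  PK : ∀ a, F (jP a) * F (jK k0) = F (jK k0) * F (jP a)
  ZK : ∀ b, F (jZ b) * F (jK k0) = F (jK k0) * F (jZ b)

theorem anti_of_add {u v x : N} (h : u + v = x) : u = (-1 : ℂ) • v + x := by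
  have h0 : (-1 : ℂ) • v + v = 0 := by
    nth_rewrite 2 [← one_smul ℂ v]
    rw [← add_smul, neg_add_cancel, zero_smul]
  rw [← h, add_left_comm, h0, add_zero]

/-- The multiplication map. -/
def Phi (fA : A →ₗ[ℂ] N) (fP : P →ₗ[ℂ] N) (fZ : Z →ₗ[ℂ] N) (fK : K →ₗ[ℂ] N) :
    VV A P Z K →ₗ[ℂ] N :=
  LinearMap.mul' ℂ N ∘ₗ TensorProduct.map (TensorAlgebra.lift ℂ fA).toLinearMap
    (LinearMap.mul' ℂ N ∘ₗ TensorProduct.map (TensorAlgebra.lift ℂ fP).toLinearMap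
      (LinearMap.mul' ℂ N ∘ₗ TensorProduct.map (TensorAlgebra.lift ℂ fZ).toLinearMap
        (TensorAlgebra.lift ℂ fK).toLinearMap))

theorem Phi_apply (fA : A →ₗ[ℂ] N) (fP : P →ₗ[ℂ] N) (fZ : Z →ₗ[ℂ] N) (fK : K →ₗ[ℂ] N)
    (w : TensorAlgebra ℂ A) (x : TensorAlgebra ℂ P) (y : TensorAlgebra ℂ Z)
    (z : TensorAlgebra ℂ K) :
    Phi fA fP fZ fK (w ⊗ₜ[ℂ] (x ⊗ₜ[ℂ] (y ⊗ₜ[ℂ] z))) =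
      TensorAlgebra.lift ℂ fA w * (TensorAlgebra.lift ℂ fP x *
        (TensorAlgebra.lift ℂ fZ y * TensorAlgebra.lift ℂ fK z)) := rfl

theorem VV_ext' {X : Type} [AddCommMonoid X] [Module ℂ X] {f g : VV A P Z K →ₗ[ℂ] X}
    (h : ∀ w x y z, f (w ⊗ₜ[ℂ] (x ⊗ₜ[ℂ] (y ⊗ₜ[ℂ] z))) = g (w ⊗ₜ[ℂ] (x ⊗ₜ[ℂ] (y ⊗ₜ[ℂ] z)))) :
    f = g := by
  refine TensorProduct.ext' fun w u => ?_
  induction u using TensorProduct.induction_on with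
  | zero => simp
  | add u v hu hv => simp [TensorProduct.tmul_add, hu, hv]
  | tmul x u =>
    induction u using TensorProduct.induction_on with
    | zero => simp
    | add u v hu hv => simp only [TensorProduct.tmul_add, map_add, hu, hv]
    | tmul y z => exact h w x y z

section inter

variable (jA : A →ₗ[ℂ] H) (jP : P →ₗ[ℂ] H) (jZ : Z →ₗ[ℂ] H) (jK : K →ₗ[ℂ] H)
    (φ : P →ₗ[ℂ] Module.Dual ℂ A) (k0 : K) (F : H →ₗ[ℂ] N)

/-- The multiplication map attached to `F`. -/
abbrev PhiF : VV A P Z K →ₗ[ℂ] N := Phi (F ∘ₗ jA) (F ∘ₗ jP) (F ∘ₗ jZ) (F ∘ₗ jK)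

theorem Phi_N (n : A) (u : VV A P Z K) :
    PhiF jA jP jZ jK F (opN n u) = F (jA n) * PhiF jA jP jZ jK F u := by
  suffices h : PhiF jA jP jZ jK F ∘ₗ opN n = LinearMap.mulLeft ℂ (F (jA n)) ∘ₗ PhiF jA jP jZ jK F from
    LinearMap.congr_fun h u
  refine VV_ext' fun w x y z => ?_
  simp only [LinearMap.comp_apply, LinearMap.mulLeft_apply, opN_apply, Phi_apply, lift_ι_mul,
    mul_assoc]

variable {jA jP jZ jK φ k0 F}

theorem Phi_K0 (hF : Rels jA jP jZ jK φ k0 F) (u : VV A P Z K) :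
    PhiF jA jP jZ jK F (opK k0 u) = F (jK k0) * PhiF jA jP jZ jK F u := by
  suffices h : PhiF jA jP jZ jK F ∘ₗ opK k0 =
      LinearMap.mulLeft ℂ (F (jK k0)) ∘ₗ PhiF jA jP jZ jK F from
    LinearMap.congr_fun h u
  refine VV_ext' fun w x y z => ?_
  simp only [LinearMap.comp_apply, LinearMap.mulLeft_apply, opK_apply, Phi_apply, lift_ι_mul]
  rw [swap_aux (lift_commute (F ∘ₗ jA) _ (fun v => (hF.NK v).symm) w),
    swap_aux (lift_commute (F ∘ₗ jP) _ (fun v => (hF.PK v).symm) x),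
    swap_aux (lift_commute (F ∘ₗ jZ) _ (fun v => (hF.ZK v).symm) y)]

theorem Phi_Z (hF : Rels jA jP jZ jK φ k0 F) (b : Z) (u : VV A P Z K) :
    PhiF jA jP jZ jK F (opZ b u) = F (jZ b) * PhiF jA jP jZ jK F u := by
  suffices h : PhiF jA jP jZ jK F ∘ₗ opZ b =
      LinearMap.mulLeft ℂ (F (jZ b)) ∘ₗ PhiF jA jP jZ jK F from
    LinearMap.congr_fun h u
  refine VV_ext' fun w x y z => ?_
  simp only [LinearMap.comp_apply, LinearMap.mulLeft_apply, opZ_apply, Phi_apply, lift_ι_mul]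
  have hA : ∀ v, F (jZ b) * (F ∘ₗ jA) v = (-1 : ℂ) • ((F ∘ₗ jA) v * F (jZ b)) := fun v => by
    simpa using anti_of_add ((add_comm _ _).trans (hF.NZ v b))
  have hP : ∀ v, F (jZ b) * (F ∘ₗ jP) v = (-1 : ℂ) • ((F ∘ₗ jP) v * F (jZ b)) := fun v => by
    simpa using anti_of_add ((add_comm _ _).trans (hF.PZ v b))
  rw [swap_aux (lift_anti (F ∘ₗ jA) _ hA w), swap_aux (lift_anti (F ∘ₗ jP) _ hP x), mul_assoc]

theorem Phi_P (hF : Rels jA jP jZ jK φ k0 F) (a : P) (u : VV A P Z K) :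
    PhiF jA jP jZ jK F ((opP1 a + opP2 k0 (φ a) : Module.End ℂ (VV A P Z K)) u) = F (jP a) * PhiF jA jP jZ jK F u := by
  suffices h : PhiF jA jP jZ jK F ∘ₗ (opP1 a + opP2 k0 (φ a)) =
      LinearMap.mulLeft ℂ (F (jP a)) ∘ₗ PhiF jA jP jZ jK F from
    LinearMap.congr_fun h u
  refine VV_ext' fun w x y z => ?_
  simp only [LinearMap.comp_apply, LinearMap.mulLeft_apply, LinearMap.add_apply, map_add,
    opP1_apply, opP2_apply, Phi_apply, lift_ι_mul]
  rw [← mul_assoc (F (jP a)), lift_PN (F ∘ₗ jA) (F (jP a)) (F (jK k0)) (φ a)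
    (fun v => (hF.NK v).symm) (fun v => anti_of_add (hF.PN a v)) w, add_mul, mul_assoc, mul_assoc,
    mul_assoc _ (F (jK k0)),
    swap_aux (lift_commute (F ∘ₗ jP) _ (fun v => (hF.PK v).symm) x),
    swap_aux (lift_commute (F ∘ₗ jZ) _ (fun v => (hF.ZK v).symm) y)]

end inter

theorem lift_act (f : A →ₗ[ℂ] N) {V : Type} [AddCommGroup V] [Module ℂ V]
    (Ψ : N →ₐ[ℂ] Module.End ℂ V) (J : TensorAlgebra ℂ A →ₗ[ℂ] V)
    (h : ∀ v x, Ψ (f v) (J x) = J (TensorAlgebra.ι ℂ v * x)) (x : TensorAlgebra ℂ A) :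
    Ψ (TensorAlgebra.lift ℂ f x) (J 1) = J x := by
  induction x using left_induction with
  | h1 => simp
  | hadd x y hx hy => simp [hx, hy]
  | hsmul r x hx => simp [hx]
  | hmul v x hx => rw [lift_ι_mul, map_mul, Module.End.mul_apply, hx, h v]

theorem main (jA : A →ₗ[ℂ] H) (jP : P →ₗ[ℂ] H) (jZ : Z →ₗ[ℂ] H) (jK : K →ₗ[ℂ] H)
    (φ : P →ₗ[ℂ] Module.Dual ℂ A) (k0 : K) (hk0 : ∀ k : K, ∃ c : ℂ, k = c • k0)
    (hext : ∀ (X : Type) [AddCommMonoid X] [Module ℂ X] (f g : H →ₗ[ℂ] X),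
      f ∘ₗ jA = g ∘ₗ jA → f ∘ₗ jP = g ∘ₗ jP → f ∘ₗ jZ = g ∘ₗ jZ → f ∘ₗ jK = g ∘ₗ jK → f = g)
    (hcop : ∀ (X : Type) [AddCommGroup X] [Module ℂ X] (gA : A →ₗ[ℂ] X) (gP : P →ₗ[ℂ] X)
      (gZ : Z →ₗ[ℂ] X) (gK : K →ₗ[ℂ] X), ∃ g : H →ₗ[ℂ] X,
      (∀ v, g (jA v) = gA v) ∧ (∀ v, g (jP v) = gP v) ∧ (∀ v, g (jZ v) = gZ v) ∧
        (∀ v, g (jK v) = gK v))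
    (F : H →ₗ[ℂ] N) (hF : Rels jA jP jZ jK φ k0 F)
    (hsurj : Function.Surjective (TensorAlgebra.lift ℂ F))
    (huniv : ∀ (E : Type) [Ring E] [Algebra ℂ E] (G : H →ₗ[ℂ] E), Rels jA jP jZ jK φ k0 G →
      ∃ Ψ : N →ₐ[ℂ] E, ∀ v, Ψ (F v) = G v) :
    ∃ e : VV A P Z K ≃ₗ[ℂ] N, ∀ w x y z, e (w ⊗ₜ[ℂ] (x ⊗ₜ[ℂ] (y ⊗ₜ[ℂ] z))) =
      TensorAlgebra.lift ℂ (F ∘ₗ jA) w * (TensorAlgebra.lift ℂ (F ∘ₗ jP) x *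
        (TensorAlgebra.lift ℂ (F ∘ₗ jZ) y * TensorAlgebra.lift ℂ (F ∘ₗ jK) z)) := by
  obtain ⟨G, gA, gP, gZ, gK⟩ := hcop (Module.End ℂ (VV A P Z K)) opN (opP1 + opP2 k0 ∘ₗ φ) opZ opK
  replace gP : ∀ v, G (jP v) = opP1 v + opP2 k0 (φ v) := gP
  have hG : Rels jA jP jZ jK φ k0 G := by
    refine ⟨fun a n => ?_, fun n b => ?_, fun a b => ?_, fun n => ?_, fun a => ?_, fun b => ?_⟩
    · rw [gP, gA, gK]; exact rel_PN a (φ a) k0 n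
    · rw [gA, gZ]; exact rel_NZ n b
    · rw [gP, gZ]; exact rel_PZ a (φ a) k0 b
    · rw [gA, gK]; exact sub_eq_zero.mp (rel_NK n k0)
    · rw [gP, gK]; exact sub_eq_zero.mp (rel_PK a (φ a) k0)
    · rw [gZ, gK]; exact sub_eq_zero.mp (rel_ZK b k0)
  obtain ⟨Ψ, hΨ⟩ := huniv (Module.End ℂ (VV A P Z K)) G hG
  have hPhi : ∀ (v : H) (u : VV A P Z K),
      PhiF jA jP jZ jK F (G v u) = F v * PhiF jA jP jZ jK F u := by
    intro v u
    suffices h : (PhiF jA jP jZ jK F ∘ₗ G.flip u) =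
        LinearMap.mulRight ℂ (PhiF jA jP jZ jK F u) ∘ₗ F from LinearMap.congr_fun h v
    refine hext _ _ _ ?_ ?_ ?_ ?_
    · ext1 n
      change PhiF jA jP jZ jK F (G (jA n) u) = _
      rw [gA, Phi_N]; rfl
    · ext1 n
      change PhiF jA jP jZ jK F (G (jP n) u) = _
      rw [gP, Phi_P hF]; rfl
    · ext1 n
      change PhiF jA jP jZ jK F (G (jZ n) u) = _
      rw [gZ, Phi_Z hF]; rfl
    · ext1 k
      change PhiF jA jP jZ jK F (G (jK k) u) = F (jK k) * PhiF jA jP jZ jK F u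
      obtain ⟨c, rfl⟩ := hk0 k
      rw [gK, map_smul, map_smul, map_smul, LinearMap.smul_apply, map_smul, Phi_K0 hF,
        smul_mul_assoc]
  have hPhi' : ∀ (n : N) (u : VV A P Z K),
      PhiF jA jP jZ jK F (Ψ n u) = n * PhiF jA jP jZ jK F u := by
    intro n u
    obtain ⟨t, rfl⟩ := hsurj n
    induction t using left_induction with
    | h1 => simp
    | hadd x y hx hy => simp only [map_add, LinearMap.add_apply, add_mul, hx, hy]
    | hsmul r x hx => simp only [map_smul, LinearMap.smul_apply, smul_mul_assoc, hx]
    | hmul v x hx =>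
      rw [lift_ι_mul, map_mul, Module.End.mul_apply, hΨ, hPhi, hx, mul_assoc]
  let vac : VV A P Z K := 1 ⊗ₜ[ℂ] (1 ⊗ₜ[ℂ] (1 ⊗ₜ[ℂ] 1))
  have hvac : PhiF jA jP jZ jK F vac = 1 := by
    rw [Phi_apply]
    simp
  have aN : ∀ (w : TensorAlgebra ℂ A) (x : TensorAlgebra ℂ P) (y : TensorAlgebra ℂ Z)
      (z : TensorAlgebra ℂ K), Ψ (TensorAlgebra.lift ℂ (F ∘ₗ jA) w)
        (1 ⊗ₜ[ℂ] (x ⊗ₜ[ℂ] (y ⊗ₜ[ℂ] z))) = w ⊗ₜ[ℂ] (x ⊗ₜ[ℂ] (y ⊗ₜ[ℂ] z)) := fun w x y z =>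
    lift_act (F ∘ₗ jA) Ψ ((TensorProduct.mk ℂ _ _).flip (x ⊗ₜ[ℂ] (y ⊗ₜ[ℂ] z))) (fun v w => by
      rw [LinearMap.comp_apply, hΨ, gA]; rfl) w
  have aP : ∀ (x : TensorAlgebra ℂ P) (y : TensorAlgebra ℂ Z)
      (z : TensorAlgebra ℂ K), Ψ (TensorAlgebra.lift ℂ (F ∘ₗ jP) x)
        (1 ⊗ₜ[ℂ] (1 ⊗ₜ[ℂ] (y ⊗ₜ[ℂ] z))) = 1 ⊗ₜ[ℂ] (x ⊗ₜ[ℂ] (y ⊗ₜ[ℂ] z)) := fun x y z =>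
    lift_act (F ∘ₗ jP) Ψ (TensorProduct.mk ℂ _ _ 1 ∘ₗ (TensorProduct.mk ℂ _ _).flip (y ⊗ₜ[ℂ] z))
      (fun v x => by
        rw [LinearMap.comp_apply, hΨ, gP]
        change opP1 _ (1 ⊗ₜ[ℂ] (x ⊗ₜ[ℂ] (y ⊗ₜ[ℂ] z)))
          + opP2 _ _ (1 ⊗ₜ[ℂ] (x ⊗ₜ[ℂ] (y ⊗ₜ[ℂ] z))) = _
        rw [opP1_apply, opP2_apply, DD_one, TensorProduct.zero_tmul, add_zero, map_one]
        rfl) x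
  have aZ : ∀ (y : TensorAlgebra ℂ Z)
      (z : TensorAlgebra ℂ K), Ψ (TensorAlgebra.lift ℂ (F ∘ₗ jZ) y)
        (1 ⊗ₜ[ℂ] (1 ⊗ₜ[ℂ] (1 ⊗ₜ[ℂ] z))) = 1 ⊗ₜ[ℂ] (1 ⊗ₜ[ℂ] (y ⊗ₜ[ℂ] z)) := fun y z =>
    lift_act (F ∘ₗ jZ) Ψ (TensorProduct.mk ℂ _ _ 1 ∘ₗ TensorProduct.mk ℂ _ _ 1 ∘ₗ
      (TensorProduct.mk ℂ _ _).flip z)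
      (fun v y => by
        rw [LinearMap.comp_apply, hΨ, gZ]
        change opZ _ (1 ⊗ₜ[ℂ] (1 ⊗ₜ[ℂ] (y ⊗ₜ[ℂ] z))) = _
        rw [opZ_apply, map_one, map_one]
        rfl) y
  have aK : ∀ (z : TensorAlgebra ℂ K), Ψ (TensorAlgebra.lift ℂ (F ∘ₗ jK) z)
        vac = 1 ⊗ₜ[ℂ] (1 ⊗ₜ[ℂ] (1 ⊗ₜ[ℂ] z)) := fun z =>
    lift_act (F ∘ₗ jK) Ψ (TensorProduct.mk ℂ _ _ 1 ∘ₗ TensorProduct.mk ℂ _ _ 1 ∘ₗ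
      TensorProduct.mk ℂ _ _ 1)
      (fun v y => by
        rw [LinearMap.comp_apply, hΨ, gK]
        rfl) z
  refine ⟨LinearEquiv.ofLinearMap (PhiF jA jP jZ jK F) (LinearMap.applyₗ vac ∘ₗ Ψ.toLinearMap)
    ?_ ?_, fun w x y z => rfl⟩
  · ext1 n
    change PhiF jA jP jZ jK F (Ψ n vac) = n
    rw [hPhi', hvac, mul_one]
  · refine VV_ext' fun w x y z => ?_
    change Ψ (PhiF jA jP jZ jK F (w ⊗ₜ[ℂ] (x ⊗ₜ[ℂ] (y ⊗ₜ[ℂ] z)))) vac = _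
    rw [Phi_apply, map_mul, map_mul, map_mul, Module.End.mul_apply, Module.End.mul_apply,
      Module.End.mul_apply, aK, aZ, aP, aN]
    rfl

end generic

theorem span_ext {H X : Type} [AddCommGroup H] [Module ℂ H] [AddCommMonoid X] [Module ℂ X]
    {s : Set H} {f g : Submodule.span ℂ s →ₗ[ℂ] X}
    (h : ∀ v (hv : v ∈ s), f ⟨v, Submodule.subset_span hv⟩ = g ⟨v, Submodule.subset_span hv⟩) :
    f = g := by
  ext ⟨v, hv⟩
  induction hv using Submodule.span_induction with
  | mem v hv => exact h v hv
  | zero => exact (map_zero f).trans (map_zero g).symm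
  | add v w hv hw h1 h2 =>
    have : (⟨v + w, Submodule.add_mem _ hv hw⟩ : Submodule.span ℂ s) = ⟨v, hv⟩ + ⟨w, hw⟩ := rfl
    rw [this, map_add, map_add, h1, h2]
  | smul c v hv h1 =>
    have : (⟨c • v, Submodule.smul_mem _ c hv⟩ : Submodule.span ℂ s) = c • ⟨v, hv⟩ := rfl
    rw [this, map_smul, map_smul, h1]

section concrete

variable {M : ℕ} (B : hSp M →ₗ[ℂ] hSp M →ₗ[ℂ] ℂ)

/-- The basis `T m` of Laurent polynomials. -/
abbrev bL : Module.Basis ℤ ℂ (LaurentPolynomial ℂ) := AddMonoidAlgebra.basis ℤ ℂ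

theorem bL_apply (m : ℤ) : bL m = LaurentPolynomial.T m := AddMonoidAlgebra.basis_apply _ _

theorem Hhat_ext {X : Type} [AddCommMonoid X] [Module ℂ X] {f g : Hhat M →ₗ[ℂ] X}
    (h : ∀ a m, f (mode a m) = g (mode a m)) (hk : f (kk M) = g (kk M)) : f = g := by
  refine LinearMap.prod_ext ?_ (LinearMap.ext_ring hk)
  refine TensorProduct.ext (LinearMap.ext fun a => bL.ext fun m => ?_)
  rw [bL_apply]
  exact h a m

/-- Linear maps out of `ĥ`. -/
def mkMap {X : Type} [AddCommMonoid X] [Module ℂ X] (f : ℤ → hSp M →ₗ[ℂ] X) (k : X) :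
    Hhat M →ₗ[ℂ] X :=
  LinearMap.coprod (TensorProduct.lift (bL.constr ℂ f).flip) (LinearMap.toSpanSingleton ℂ _ k)

theorem mkMap_mode {X : Type} [AddCommMonoid X] [Module ℂ X] (f : ℤ → hSp M →ₗ[ℂ] X) (k : X)
    (a : hSp M) (m : ℤ) : mkMap f k (mode a m) = f m a := by
  rw [mkMap, mode, LinearMap.coprod_apply, map_zero, add_zero, TensorProduct.lift.tmul,
    LinearMap.flip_apply, ← bL_apply, Module.Basis.constr_basis]

theorem mkMap_kk {X : Type} [AddCommMonoid X] [Module ℂ X] (f : ℤ → hSp M →ₗ[ℂ] X) (k : X) :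
    mkMap f k (kk M) = k := by
  rw [mkMap, kk, LinearMap.coprod_apply, map_zero, zero_add, LinearMap.toSpanSingleton_apply,
    one_smul]

/-- `a ↦ a ⊗ tᵐ` -/
def modeL (m : ℤ) : hSp M →ₗ[ℂ] Hhat M :=
  LinearMap.inl ℂ _ _ ∘ₗ (TensorProduct.mk ℂ (hSp M) (LaurentPolynomial ℂ)).flip
    (LaurentPolynomial.T m)

theorem modeL_apply (m : ℤ) (a : hSp M) : modeL m a = mode a m := rfl

def modeN (m : ℤ) (hm : m < 0) : hSp M →ₗ[ℂ] negPart M :=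
  (modeL m).codRestrict _ fun a => Submodule.subset_span ⟨a, m, hm, rfl⟩

def modeP (m : ℤ) (hm : 0 < m) : hSp M →ₗ[ℂ] posPart M :=
  (modeL m).codRestrict _ fun a => Submodule.subset_span ⟨a, m, hm, rfl⟩

variable (M) in
def modeZ : hSp M →ₗ[ℂ] zeroPart M :=
  (modeL 0).codRestrict _ fun a => Submodule.subset_span ⟨a, rfl⟩

variable (M) in
def k0 : kPart M := ⟨kk M, Submodule.subset_span rfl⟩

/-- The pairing. -/
def pairing : Hhat M →ₗ[ℂ] Module.Dual ℂ (Hhat M) :=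
  mkMap (fun m => (m : ℂ) • (mkMap (fun n => if m + n = 0 then B.flip else 0) 0).flip) 0

theorem pairing_apply (a b : hSp M) (m n : ℤ) :
    pairing B (mode a m) (mode b n) = if m + n = 0 then (m : ℂ) * B a b else 0 := by
  rw [pairing, mkMap_mode, LinearMap.smul_apply, LinearMap.smul_apply, LinearMap.flip_apply,
    mkMap_mode]
  split_ifs <;> simp

variable (M) in
def phi : posPart M →ₗ[ℂ] Module.Dual ℂ (negPart M) :=
  (Module.Dual.transpose (negPart M).subtype) ∘ₗ pairing B ∘ₗ (posPart M).subtype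

theorem phi_apply (a : posPart M) (n : negPart M) : phi M B a n = pairing B a n := rfl

/-- `ĥ → N`. -/
def cN : Hhat M →ₗ[ℂ] NA M B := (mkN M B).toLinearMap ∘ₗ TensorAlgebra.ι ℂ

theorem cN_eq (v : Hhat M) : cN B v = mkN M B (ιT v) := rfl

theorem mkN_rel {x y : TA M} (hx : x - y ∈ genSet M B) : mkN M B x = mkN M B y := by
  have h := RingQuot.mkAlgHom_rel ℂ (s := genRel M B) (x := x - y) (y := 0) ⟨hx, rfl⟩
  have h' : mkN M B (x - y) = 0 := h.trans (map_zero _)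
  rw [← sub_add_cancel x y, map_add, h', zero_add]

theorem cN_PN (a b : hSp M) (m n : ℤ) (hm : 0 < m) (hn : n < 0) :
    cN B (mode a m) * cN B (mode b n) + cN B (mode b n) * cN B (mode a m)
      = (if m + n = 0 then (m : ℂ) * B a b else 0) • cN B (kk M) := by
  have := mkN_rel B (Or.inl (Or.inl ⟨a, b, m, n, hm, hn, rfl⟩))
  rw [map_add, map_mul, map_mul, map_smul] at this
  exact this

theorem cN_Z (a b : hSp M) (p : ℤ) (hp : p ≠ 0) :
    cN B (mode a p) * cN B (mode b 0) + cN B (mode b 0) * cN B (mode a p) = 0 := by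
  have := mkN_rel B (y := 0) (Or.inl (Or.inr ⟨a, b, p, hp, sub_zero _⟩))
  rw [map_add, map_mul, map_mul, map_zero] at this
  exact this

theorem cN_K (a : hSp M) (q : ℤ) :
    cN B (mode a q) * cN B (kk M) = cN B (kk M) * cN B (mode a q) := by
  have := mkN_rel B (Or.inr ⟨a, q, rfl⟩)
  rw [map_mul, map_mul] at this
  exact this

theorem span_bilin {H N : Type} [AddCommGroup H] [Module ℂ H] [Semiring N] [Algebra ℂ N]
    {s t : Set H} (F : H →ₗ[ℂ] N) (β : H →ₗ[ℂ] Module.Dual ℂ H) (k : N)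
    (h : ∀ v ∈ s, ∀ w ∈ t, F v * F w + F w * F v = β v w • k) (v w : H)
    (hv : v ∈ Submodule.span ℂ s) (hw : w ∈ Submodule.span ℂ t) :
    F v * F w + F w * F v = β v w • k := by
  induction hv using Submodule.span_induction with
  | zero => simp
  | add x y hx hy h1 h2 =>
    simp only [map_add, LinearMap.add_apply, add_mul, mul_add, add_smul, ← h1, ← h2]
    abel
  | smul c x hx h1 => simp [← h1, mul_smul]
  | mem v hv =>
    induction hw using Submodule.span_induction with
    | zero => simp
    | add x y hx hy h1 h2 =>
      simp only [map_add, add_mul, mul_add, add_smul, ← h1, ← h2]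
      abel
    | smul c x hx h1 => simp [← h1, mul_smul]
    | mem w hw => exact h v hv w hw

theorem span_comm {H N : Type} [AddCommGroup H] [Module ℂ H] [Semiring N] [Algebra ℂ N]
    {s : Set H} (F : H →ₗ[ℂ] N) (k : N) (h : ∀ v ∈ s, F v * k = k * F v) (v : H)
    (hv : v ∈ Submodule.span ℂ s) : F v * k = k * F v := by
  induction hv using Submodule.span_induction with
  | zero => simp
  | add x y hx hy h1 h2 => simp only [map_add, add_mul, mul_add, h1, h2]
  | smul c x hx h1 => simp [h1]
  | mem v hv => exact h v hv

variable (M) in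
abbrev RelsM {E : Type} [Semiring E] [Algebra ℂ E] (F : Hhat M →ₗ[ℂ] E) : Prop :=
  Rels (A := negPart M) (P := posPart M) (Z := zeroPart M) (K := kPart M) (H := Hhat M)
    (negPart M).subtype (posPart M).subtype (zeroPart M).subtype (kPart M).subtype
    (phi M B) (k0 M) F

theorem rels_cN : RelsM M B (cN B) := by
  refine ⟨fun a n => ?_, fun n b => ?_, fun a b => ?_, fun n => ?_, fun a => ?_, fun b => ?_⟩
  · refine span_bilin (cN B) (pairing B) (cN B (kk M)) ?_ _ _ a.2 n.2
    rintro _ ⟨a, m, hm, rfl⟩ _ ⟨b, n, hn, rfl⟩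
    rw [pairing_apply, cN_PN B a b m n hm hn]
  · refine (span_bilin (cN B) 0 0 ?_ _ _ n.2 b.2).trans (smul_zero _)
    rintro _ ⟨a, m, hm, rfl⟩ _ ⟨b, rfl⟩
    rw [cN_Z B a b m hm.ne, smul_zero]
  · refine (span_bilin (cN B) 0 0 ?_ _ _ a.2 b.2).trans (smul_zero _)
    rintro _ ⟨a, m, hm, rfl⟩ _ ⟨b, rfl⟩
    rw [cN_Z B a b m hm.ne', smul_zero]
  · refine span_comm (cN B) (cN B (kk M)) ?_ _ n.2
    rintro _ ⟨a, m, hm, rfl⟩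
    exact cN_K B a m
  · refine span_comm (cN B) (cN B (kk M)) ?_ _ a.2
    rintro _ ⟨a, m, hm, rfl⟩
    exact cN_K B a m
  · refine span_comm (cN B) (cN B (kk M)) ?_ _ b.2
    rintro _ ⟨a, rfl⟩
    exact cN_K B a 0

theorem lift_gen {E : Type} [Ring E] [Algebra ℂ E] (G : Hhat M →ₗ[ℂ] E) (hG : RelsM M B G)
    {x : TA M} (hx : x ∈ genSet M B) : TensorAlgebra.lift ℂ G x = 0 := by
  rcases hx with (⟨a, b, m, n, hm, hn, rfl⟩ | ⟨a, b, p, hp, rfl⟩) | ⟨a, q, rfl⟩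
  · simp only [map_sub, map_add, map_mul, map_smul, ιT, TensorAlgebra.lift_ι_apply]
    rw [sub_eq_zero, ← pairing_apply]
    exact hG.PN (modeP m hm a) (modeN n hn b)
  · simp only [map_add, map_mul, ιT, TensorAlgebra.lift_ι_apply]
    rcases lt_or_gt_of_ne hp with h | h
    · exact hG.NZ (modeN p h a) (modeZ M b)
    · exact hG.PZ (modeP p h a) (modeZ M b)
  · simp only [map_sub, map_mul, ιT, TensorAlgebra.lift_ι_apply]
    rw [sub_eq_zero]
    rcases lt_trichotomy q 0 with h | h | h
    · exact hG.NK (modeN q h a)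
    · subst h
      exact hG.ZK (modeZ M a)
    · exact hG.PK (modeP q h a)

theorem univ_cN (E : Type) [Ring E] [Algebra ℂ E] (G : Hhat M →ₗ[ℂ] E) (hG : RelsM M B G) :
    ∃ Ψ : NA M B →ₐ[ℂ] E, ∀ v, Ψ (cN B v) = G v := by
  refine ⟨RingQuot.liftAlgHom ℂ ⟨TensorAlgebra.lift ℂ G, ?_⟩, fun v => ?_⟩
  · rintro x y ⟨hx, rfl⟩
    rw [lift_gen B G hG hx, map_zero]
  · rw [cN_eq, mkN, RingQuot.liftAlgHom_mkAlgHom_apply, ιT, TensorAlgebra.lift_ι_apply]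

theorem hext_M (X : Type) [AddCommMonoid X] [Module ℂ X] (f g : Hhat M →ₗ[ℂ] X)
    (hA : f ∘ₗ (negPart M).subtype = g ∘ₗ (negPart M).subtype)
    (hP : f ∘ₗ (posPart M).subtype = g ∘ₗ (posPart M).subtype)
    (hZ : f ∘ₗ (zeroPart M).subtype = g ∘ₗ (zeroPart M).subtype)
    (hK : f ∘ₗ (kPart M).subtype = g ∘ₗ (kPart M).subtype) : f = g := by
  refine Hhat_ext (fun a m => ?_) (LinearMap.congr_fun hK (k0 M))
  rcases lt_trichotomy m 0 with h | h | h
  · exact LinearMap.congr_fun hA (modeN m h a)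
  · subst h
    exact LinearMap.congr_fun hZ (modeZ M a)
  · exact LinearMap.congr_fun hP (modeP m h a)

theorem hcop_M (X : Type) [AddCommGroup X] [Module ℂ X] (gA : negPart M →ₗ[ℂ] X)
    (gP : posPart M →ₗ[ℂ] X) (gZ : zeroPart M →ₗ[ℂ] X) (gK : kPart M →ₗ[ℂ] X) :
    ∃ g : Hhat M →ₗ[ℂ] X,
      (∀ v, g ((negPart M).subtype v) = gA v) ∧ (∀ v, g ((posPart M).subtype v) = gP v) ∧
      (∀ v, g ((zeroPart M).subtype v) = gZ v) ∧ (∀ v, g ((kPart M).subtype v) = gK v) := by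
  let f : ℤ → hSp M →ₗ[ℂ] X := fun m =>
    if h : m < 0 then gA ∘ₗ modeN m h
    else if h : 0 < m then gP ∘ₗ modeP m h
    else gZ ∘ₗ modeZ M
  have fN : ∀ m (h : m < 0) a, f m a = gA (modeN m h a) := fun m h a => by simp [f, h]
  have fP : ∀ m (h : 0 < m) a, f m a = gP (modeP m h a) := fun m h a => by
    simp [f, h, not_lt.mpr h.le]
  have fZ : ∀ a, f 0 a = gZ (modeZ M a) := fun a => by simp [f]
  let g := mkMap f (gK (k0 M))
  refine ⟨g, fun v => ?_, fun v => ?_, fun v => ?_, fun v => ?_⟩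
  · refine LinearMap.congr_fun (f := g ∘ₗ (negPart M).subtype) (span_ext ?_) v
    rintro _ ⟨a, m, hm, rfl⟩
    exact (mkMap_mode _ _ _ _).trans (fN m hm a)
  · refine LinearMap.congr_fun (f := g ∘ₗ (posPart M).subtype) (span_ext ?_) v
    rintro _ ⟨a, m, hm, rfl⟩
    exact (mkMap_mode _ _ _ _).trans (fP m hm a)
  · refine LinearMap.congr_fun (f := g ∘ₗ (zeroPart M).subtype) (span_ext ?_) v
    rintro _ ⟨a, rfl⟩
    exact (mkMap_mode _ _ _ _).trans (fZ a)
  · refine LinearMap.congr_fun (f := g ∘ₗ (kPart M).subtype) (span_ext ?_) v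
    rintro _ rfl
    exact mkMap_kk _ _

theorem hk0_M (k : kPart M) : ∃ c : ℂ, k = c • k0 M := by
  obtain ⟨c, hc⟩ := Submodule.mem_span_singleton.mp k.2
  exact ⟨c, Subtype.ext hc.symm⟩

theorem surj_cN : Function.Surjective (TensorAlgebra.lift ℂ (cN B)) := by
  have h : TensorAlgebra.lift ℂ (cN B) = mkN M B := by
    ext1
    exact TensorAlgebra.ι_comp_lift (cN B)
  rw [h]
  exact RingQuot.mkAlgHom_surjective ℂ (genRel M B)

theorem assoc4 {R : Type} [Semiring R] (a b c d : R) :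
    a * (b * (c * d)) = a * b * c * d := by
  rw [mul_assoc, mul_assoc]

/-- The generic theorem applied to the concrete data; a `def` so that its type is inferred. -/
def mainConcrete := main (A := negPart M) (P := posPart M) (Z := zeroPart M)
    (K := kPart M) (H := Hhat M) (N := NA M B) (negPart M).subtype (posPart M).subtype
    (zeroPart M).subtype (kPart M).subtype (phi M B) (k0 M) hk0_M
    (fun X _ _ f g => hext_M X f g) (fun X _ _ => hcop_M X) (cN B)
    (rels_cN B) (surj_cN B) (fun E _ _ => univ_cN B E)

end concrete

end NAProof

/-- As a vector space, `N(ĥ_ℤ) ≅ T(ĥ_ℤ⁻) ⊗ T(ĥ_ℤ⁺) ⊗ T(h⊗t⁰) ⊗ T(ℂk)`: the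
linear map sending `u⁻ ⊗ u⁺ ⊗ u⁰ ⊗ uᵏ` to the image in `N(ĥ_ℤ)` of the product
`u⁻·u⁺·u⁰·uᵏ` is a linear isomorphism. -/
theorem na_tensor_decomposition (M : ℕ) (B : hSp M →ₗ[ℂ] hSp M →ₗ[ℂ] ℂ)
    (hsymm : ∀ a b, B a b = B b a)
    (hnd : ∀ a : hSp M, (∀ b : hSp M, B a b = 0) → a = 0) :
    ∃ e : (TensorAlgebra ℂ (negPart M) ⊗[ℂ] (TensorAlgebra ℂ (posPart M) ⊗[ℂ]
          (TensorAlgebra ℂ (zeroPart M) ⊗[ℂ] TensorAlgebra ℂ (kPart M)))) ≃ₗ[ℂ] NA M B,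
      ∀ (w : TensorAlgebra ℂ (negPart M)) (x : TensorAlgebra ℂ (posPart M))
        (y : TensorAlgebra ℂ (zeroPart M)) (z : TensorAlgebra ℂ (kPart M)),
        e (w ⊗ₜ[ℂ] (x ⊗ₜ[ℂ] (y ⊗ₜ[ℂ] z))) =
          partMap M B (negPart M) w * partMap M B (posPart M) x *
            partMap M B (zeroPart M) y * partMap M B (kPart M) z := by
  obtain ⟨e, he⟩ := NAProof.mainConcrete B
  exact ⟨e, fun w x y z => (he w x y z).trans (NAProof.assoc4 _ _ _ _)⟩

end
end

section
/- T(ĥ_ℤ) = S + J; that is, every element of the tensor algebra T(ĥ_ℤ) is the sum of an element of S (a linear combination of ordered monomials: negative modes first, then positive modes, then zero modes, then tensor powers of k) and an element of the ideal J. -/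
open TensorProduct

noncomputable section

/-- The two-sided ideal `J` generated by `genSet`, realized as the `ℂ`-span of
the products `a·g·b` with `g` a generator (as a subspace of `T(ĥ_ℤ)`). -/
def Jsub (M : ℕ) (B : hSp M →ₗ[ℂ] hSp M →ₗ[ℂ] ℂ) : Submodule ℂ (TA M) :=
  Submodule.span ℂ {x | ∃ (a g b : TA M), g ∈ genSet M B ∧ x = a * g * b}

/-- The set of ordered monomials: negative modes first, then positive modes,
then zero modes, then tensor powers of `k`. -/
def orderedMonomials (M : ℕ) : Set (TA M) :=
  {x | ∃ (j l p q : ℕ) (hn : Fin j → hSp M) (mn : Fin j → ℕ)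
        (hp : Fin l → hSp M) (np : Fin l → ℕ) (hz : Fin p → hSp M),
      (∀ i, 1 ≤ mn i) ∧ (∀ i, 1 ≤ np i) ∧
      x = (List.ofFn fun i => ιT (mode (hn i) (-(mn i : ℤ)))).prod *
            (List.ofFn fun i => ιT (mode (hp i) ((np i : ℤ)))).prod *
            (List.ofFn fun i => ιT (mode (hz i) 0)).prod *
            (ιT (kk M)) ^ q}

/-- The subspace `S` spanned by the ordered monomials. -/
def Ssub (M : ℕ) : Submodule ℂ (TA M) :=
  Submodule.span ℂ (orderedMonomials M)

/-- Products of zero modes times a power of `k`. -/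
inductive Zm (M : ℕ) : TA M → Prop
  | base (q : ℕ) : Zm M ((ιT (kk M)) ^ q)
  | step (a : hSp M) (x : TA M) : Zm M x → Zm M (ιT (mode a 0) * x)

/-- Products of positive modes times a `Zm`. -/
inductive Pm (M : ℕ) : TA M → Prop
  | base (x : TA M) : Zm M x → Pm M x
  | step (a : hSp M) (n : ℕ) (hn : 1 ≤ n) (x : TA M) : Pm M x → Pm M (ιT (mode a (n : ℤ)) * x)

/-- Products of negative modes times a `Pm`. -/
inductive Nm (M : ℕ) : TA M → Prop
  | base (x : TA M) : Pm M x → Nm M x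
  | step (a : hSp M) (n : ℕ) (hn : 1 ≤ n) (x : TA M) : Nm M x →
      Nm M (ιT (mode a (-(n : ℤ))) * x)

theorem Zm.form {M : ℕ} {x : TA M} (h : Zm M x) : ∃ (p q : ℕ) (hz : Fin p → hSp M),
    x = (List.ofFn fun i => ιT (mode (hz i) 0)).prod * (ιT (kk M)) ^ q := by
  induction h with
  | base q => exact ⟨0, q, Fin.elim0, by simp⟩
  | step a x _ ih =>
    obtain ⟨p, q, hz, rfl⟩ := ih
    refine ⟨p + 1, q, Fin.cons a hz, ?_⟩
    simp [List.ofFn_succ, mul_assoc]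

theorem Pm.form {M : ℕ} {x : TA M} (h : Pm M x) : ∃ (l p q : ℕ)
    (hp : Fin l → hSp M) (np : Fin l → ℕ) (hz : Fin p → hSp M), (∀ i, 1 ≤ np i) ∧
    x = (List.ofFn fun i => ιT (mode (hp i) ((np i : ℤ)))).prod *
      (List.ofFn fun i => ιT (mode (hz i) 0)).prod * (ιT (kk M)) ^ q := by
  induction h with
  | base x hx =>
    obtain ⟨p, q, hz, rfl⟩ := hx.form
    exact ⟨0, p, q, Fin.elim0, Fin.elim0, hz, fun i => i.elim0, by simp⟩
  | step a n hn x _ ih =>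
    obtain ⟨l, p, q, hp, np, hz, h1, rfl⟩ := ih
    refine ⟨l + 1, p, q, Fin.cons a hp, Fin.cons n np, hz, ?_, ?_⟩
    · intro i
      refine Fin.cases ?_ ?_ i
      · simpa using hn
      · simpa using h1
    · simp [List.ofFn_succ, mul_assoc]

theorem Nm.form {M : ℕ} {x : TA M} (h : Nm M x) : x ∈ orderedMonomials M := by
  induction h with
  | base x hx =>
    obtain ⟨l, p, q, hp, np, hz, h1, rfl⟩ := hx.form
    exact ⟨0, l, p, q, Fin.elim0, Fin.elim0, hp, np, hz, fun i => i.elim0, h1, by simp⟩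
  | step a n hn x _ ih =>
    obtain ⟨j, l, p, q, hn', mn, hp, np, hz, h0, h1, rfl⟩ := ih
    refine ⟨j + 1, l, p, q, Fin.cons a hn', Fin.cons n mn, hp, np, hz, ?_, h1, ?_⟩
    · intro i
      refine Fin.cases ?_ ?_ i
      · simpa using hn
      · simpa using h0
    · simp [List.ofFn_succ, mul_assoc]

/-- The sum of the span of ordered monomials and the ideal. -/
def Wsub (M : ℕ) (B : hSp M →ₗ[ℂ] hSp M →ₗ[ℂ] ℂ) : Submodule ℂ (TA M) :=
  Submodule.span ℂ {x | Nm M x} ⊔ Jsub M B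

theorem Jsub_mul_left {M : ℕ} {B : hSp M →ₗ[ℂ] hSp M →ₗ[ℂ] ℂ} (y : TA M) {x : TA M}
    (hx : x ∈ Jsub M B) : y * x ∈ Jsub M B := by
  unfold Jsub at hx
  induction hx using Submodule.span_induction with
  | mem x h =>
    obtain ⟨a, g, b, hg, rfl⟩ := h
    exact Submodule.subset_span ⟨y * a, g, b, hg, by simp only [mul_assoc]⟩
  | zero => rw [mul_zero]; exact Submodule.zero_mem _
  | add u v _ _ hu hv => rw [mul_add]; exact Submodule.add_mem _ hu hv
  | smul c u _ hu => rw [mul_smul_comm]; exact Submodule.smul_mem _ c hu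

theorem gen_mul_mem {M : ℕ} {B : hSp M →ₗ[ℂ] hSp M →ₗ[ℂ] ℂ} {g : TA M}
    (hg : g ∈ genSet M B) (x : TA M) : g * x ∈ Wsub M B :=
  Submodule.mem_sup_right (Submodule.subset_span ⟨1, g, x, hg, by rw [one_mul]⟩)

theorem Nm.mem {M : ℕ} (B : hSp M →ₗ[ℂ] hSp M →ₗ[ℂ] ℂ) {x : TA M} (h : Nm M x) :
    x ∈ Wsub M B :=
  Submodule.mem_sup_left (Submodule.subset_span h)

theorem W_mul {M : ℕ} {B : hSp M →ₗ[ℂ] hSp M →ₗ[ℂ] ℂ} {y : TA M}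
    (h : ∀ x, Nm M x → y * x ∈ Wsub M B) {w : TA M} (hw : w ∈ Wsub M B) :
    y * w ∈ Wsub M B := by
  obtain ⟨s, hs, z, hz, rfl⟩ := Submodule.mem_sup.1 hw
  rw [mul_add]
  refine Submodule.add_mem _ ?_ (Submodule.mem_sup_right (Jsub_mul_left y hz))
  clear hw
  induction hs using Submodule.span_induction with
  | mem x hx => exact h x hx
  | zero => rw [mul_zero]; exact Submodule.zero_mem _
  | add u v _ _ hu hv => rw [mul_add]; exact Submodule.add_mem _ hu hv
  | smul c u _ hu => rw [mul_smul_comm]; exact Submodule.smul_mem _ c hu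

theorem W_neg {M : ℕ} {B : hSp M →ₗ[ℂ] hSp M →ₗ[ℂ] ℂ} (a : hSp M) (n : ℕ) (hn : 1 ≤ n)
    {w : TA M} (hw : w ∈ Wsub M B) : ιT (mode a (-(n : ℤ))) * w ∈ Wsub M B :=
  W_mul (fun x hx => (Nm.step a n hn x hx).mem B) hw

theorem gen_z {M : ℕ} {B : hSp M →ₗ[ℂ] hSp M →ₗ[ℂ] ℂ} (a b : hSp M) (m : ℤ) (hm : m ≠ 0)
    {x : TA M} (h : ιT (mode a m) * (ιT (mode b 0) * x) ∈ Wsub M B) :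
    ιT (mode b 0) * (ιT (mode a m) * x) ∈ Wsub M B := by
  have hg : ιT (mode a m) * ιT (mode b 0) + ιT (mode b 0) * ιT (mode a m) ∈ genSet M B :=
    Or.inl (Or.inr ⟨a, b, m, hm, rfl⟩)
  have := Submodule.sub_mem _ (gen_mul_mem hg x) h
  rw [add_mul, mul_assoc, mul_assoc, add_sub_cancel_left] at this
  exact this

theorem k_step {M : ℕ} {B : hSp M →ₗ[ℂ] hSp M →ₗ[ℂ] ℂ} (a : hSp M) (m : ℤ) {x z : TA M}
    (hj : ιT (kk M) * x - z ∈ Jsub M B) :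
    ιT (kk M) * (ιT (mode a m) * x) - ιT (mode a m) * z ∈ Jsub M B := by
  have hg : ιT (mode a m) * ιT (kk M) - ιT (kk M) * ιT (mode a m) ∈ genSet M B :=
    Or.inr ⟨a, m, rfl⟩
  have h1 : (ιT (mode a m) * ιT (kk M) - ιT (kk M) * ιT (mode a m)) * x ∈ Jsub M B :=
    Submodule.subset_span ⟨1, _, x, hg, by rw [one_mul]⟩
  have h2 := Submodule.sub_mem _ (Jsub_mul_left (ιT (mode a m)) hj) h1
  convert h2 using 1
  rw [mul_sub, sub_mul, mul_assoc, mul_assoc]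
  abel

theorem kk_Zm {M : ℕ} (B : hSp M →ₗ[ℂ] hSp M →ₗ[ℂ] ℂ) {x : TA M} (hx : Zm M x) :
    ∃ z, Zm M z ∧ ιT (kk M) * x - z ∈ Jsub M B := by
  induction hx with
  | base q =>
    refine ⟨_, Zm.base (q + 1), ?_⟩
    rw [pow_succ', sub_self]; exact Submodule.zero_mem _
  | step a x _ ih =>
    obtain ⟨z, hz, hj⟩ := ih
    exact ⟨_, Zm.step a z hz, k_step a 0 hj⟩

theorem kk_Pm {M : ℕ} (B : hSp M →ₗ[ℂ] hSp M →ₗ[ℂ] ℂ) {x : TA M} (hx : Pm M x) :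
    ∃ z, Pm M z ∧ ιT (kk M) * x - z ∈ Jsub M B := by
  induction hx with
  | base x hx =>
    obtain ⟨z, hz, hj⟩ := kk_Zm B hx
    exact ⟨z, Pm.base z hz, hj⟩
  | step a n hn x _ ih =>
    obtain ⟨z, hz, hj⟩ := ih
    exact ⟨_, Pm.step a n hn z hz, k_step a _ hj⟩

theorem kk_Nm {M : ℕ} (B : hSp M →ₗ[ℂ] hSp M →ₗ[ℂ] ℂ) {x : TA M} (hx : Nm M x) :
    ∃ z, Nm M z ∧ ιT (kk M) * x - z ∈ Jsub M B := by
  induction hx with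
  | base x hx =>
    obtain ⟨z, hz, hj⟩ := kk_Pm B hx
    exact ⟨z, Nm.base z hz, hj⟩
  | step a n hn x _ ih =>
    obtain ⟨z, hz, hj⟩ := ih
    exact ⟨_, Nm.step a n hn z hz, k_step a _ hj⟩

theorem W_kk {M : ℕ} {B : hSp M →ₗ[ℂ] hSp M →ₗ[ℂ] ℂ} {w : TA M} (hw : w ∈ Wsub M B) :
    ιT (kk M) * w ∈ Wsub M B := by
  refine W_mul (fun x hx => ?_) hw
  obtain ⟨z, hz, hj⟩ := kk_Nm B hx
  have := Submodule.add_mem _ (Submodule.mem_sup_right hj) (hz.mem B)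
  rwa [sub_add_cancel] at this

theorem W_pos {M : ℕ} {B : hSp M →ₗ[ℂ] hSp M →ₗ[ℂ] ℂ} (a : hSp M) (n : ℕ) (hn : 1 ≤ n)
    {w : TA M} (hw : w ∈ Wsub M B) : ιT (mode a (n : ℤ)) * w ∈ Wsub M B := by
  refine W_mul (fun x hx => ?_) hw
  induction hx with
  | base x hx => exact (Nm.base _ (Pm.step a n hn x hx)).mem B
  | step b m hm x hx ih =>
    have hg : ιT (mode a (n : ℤ)) * ιT (mode b (-(m : ℤ)))
        + ιT (mode b (-(m : ℤ))) * ιT (mode a (n : ℤ))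
        - (if (n : ℤ) + -(m : ℤ) = 0 then (((n : ℤ) : ℂ)) * B a b else 0) • ιT (kk M)
        ∈ genSet M B :=
      Or.inl (Or.inl ⟨a, b, n, -(m : ℤ), by omega, by omega, rfl⟩)
    generalize (if (n : ℤ) + -(m : ℤ) = 0 then (((n : ℤ) : ℂ)) * B a b else 0) = c at hg
    have h1 := Submodule.add_mem _ (Submodule.sub_mem _ (gen_mul_mem hg x) (W_neg b m hm ih))
      (Submodule.smul_mem _ c (W_kk (hx.mem B)))
    convert h1 using 1
    rw [sub_mul, add_mul, mul_assoc, mul_assoc, smul_mul_assoc]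
    abel

theorem W_zero {M : ℕ} {B : hSp M →ₗ[ℂ] hSp M →ₗ[ℂ] ℂ} (a : hSp M)
    {w : TA M} (hw : w ∈ Wsub M B) : ιT (mode a 0) * w ∈ Wsub M B := by
  refine W_mul (fun x hx => ?_) hw
  induction hx with
  | base x hx =>
    induction hx with
    | base x hx => exact (Nm.base _ (Pm.base _ (Zm.step a x hx))).mem B
    | step b m hm x hx ih => exact gen_z b a _ (by omega) (W_pos b m hm ih)
  | step b m hm x hx ih => exact gen_z b a _ (by omega) (W_neg b m hm ih)

theorem W_mode {M : ℕ} {B : hSp M →ₗ[ℂ] hSp M →ₗ[ℂ] ℂ} (a : hSp M) (m : ℤ)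
    {w : TA M} (hw : w ∈ Wsub M B) : ιT (mode a m) * w ∈ Wsub M B := by
  rcases lt_trichotomy m 0 with h | h | h
  · have := W_neg a m.natAbs (by omega) hw
    rwa [show -(m.natAbs : ℤ) = m by omega] at this
  · subst h; exact W_zero a hw
  · have := W_pos a m.natAbs (by omega) hw
    rwa [show (m.natAbs : ℤ) = m by omega] at this

theorem W_iota {M : ℕ} {B : hSp M →ₗ[ℂ] hSp M →ₗ[ℂ] ℂ} (v : Hhat M)
    {w : TA M} (hw : w ∈ Wsub M B) : TensorAlgebra.ι ℂ v * w ∈ Wsub M B := by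
  obtain ⟨u, c⟩ := v
  have hsplit : ((u, c) : Hhat M) = LinearMap.inl ℂ _ _ u + c • kk M := by
    simp [kk]
  rw [hsplit, map_add, map_smul, add_mul, smul_mul_assoc]
  refine Submodule.add_mem _ ?_ (Submodule.smul_mem _ c (W_kk hw))
  induction u using TensorProduct.induction_on with
  | zero => rw [map_zero, map_zero, zero_mul]; exact Submodule.zero_mem _
  | add x y hx hy =>
    rw [map_add, map_add, add_mul]
    exact Submodule.add_mem _ (hx (by simp [kk])) (hy (by simp [kk]))
  | tmul a f =>
    clear hsplit
    induction f using LaurentPolynomial.induction_on' with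
    | add p q hp hq =>
      rw [TensorProduct.tmul_add, map_add, map_add, add_mul]
      exact Submodule.add_mem _ hp hq
    | C_mul_T n r =>
      have : (LaurentPolynomial.C r * LaurentPolynomial.T n : LaurentPolynomial ℂ)
          = r • LaurentPolynomial.T n := (LaurentPolynomial.smul_eq_C_mul r _).symm
      rw [this, TensorProduct.tmul_smul, map_smul, map_smul, smul_mul_assoc]
      exact Submodule.smul_mem _ r (W_mode a n hw)

theorem W_all {M : ℕ} {B : hSp M →ₗ[ℂ] hSp M →ₗ[ℂ] ℂ} (x : TA M) :
    ∀ w ∈ Wsub M B, x * w ∈ Wsub M B := by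
  induction x using TensorAlgebra.induction with
  | algebraMap r =>
    intro w hw
    rw [← Algebra.smul_def]; exact Submodule.smul_mem _ r hw
  | ι v => exact fun w hw => W_iota v hw
  | mul a b ha hb => intro w hw; rw [mul_assoc]; exact ha _ (hb _ hw)
  | add a b ha hb => intro w hw; rw [add_mul]; exact Submodule.add_mem _ (ha _ hw) (hb _ hw)

/-- `T(ĥ_ℤ) = S + J`: every element of the tensor algebra is the sum of a
linear combination of ordered monomials and an element of the ideal `J`. -/
theorem ta_eq_span_add_ideal (M : ℕ) (B : hSp M →ₗ[ℂ] hSp M →ₗ[ℂ] ℂ)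
    (hsymm : ∀ a b, B a b = B b a)
    (hnd : ∀ a : hSp M, (∀ b : hSp M, B a b = 0) → a = 0) :
    ∀ x : TA M, ∃ s ∈ Ssub M, ∃ y ∈ Jsub M B, x = s + y := by
  intro x
  have h1 : (1 : TA M) ∈ Wsub M B := by
    have := (Nm.base _ (Pm.base _ (Zm.base (M := M) 0))).mem B
    rwa [pow_zero] at this
  have hx := W_all x 1 h1
  rw [mul_one] at hx
  obtain ⟨s, hs, y, hy, h⟩ := Submodule.mem_sup.1 hx
  exact ⟨s, Submodule.span_mono (fun z hz => Nm.form hz) hs, y, hy, h.symm⟩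

end
end

section
/- There exists a ℂ-linear map L : T(ĥ_ℤ) → T(ĥ_ℤ) such that L vanishes on the ideal J and L restricts to the identity map on the subspace S. (Consequently S ∩ J = 0, i.e., the sum T(ĥ_ℤ) = S + J is direct.) -/
open TensorProduct

noncomputable section

namespace Retr

section abstractPart

variable {V : Type} [AddCommGroup V] [Module ℂ V]

/-- Local shorthand for the tensor algebra. -/
abbrev T (V : Type) [AddCommGroup V] [Module ℂ V] : Type := TensorAlgebra ℂ V

/-- The module carrying the representation. -/
abbrev N (V : Type) [AddCommGroup V] [Module ℂ V] : Type :=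
  TensorProduct ℂ (T V) (TensorProduct ℂ (T V) (TensorProduct ℂ (T V) (T V)))

/-- Left multiplication by a generator. -/
def lm : V →ₗ[ℂ] T V →ₗ[ℂ] T V := (LinearMap.mul ℂ (T V)).comp (TensorAlgebra.ι ℂ)

lemma lm_apply (v : V) (x : T V) : lm v x = TensorAlgebra.ι ℂ v * x := rfl

/-- The grade involution. -/
def al : T V →ₗ[ℂ] T V := (TensorAlgebra.lift ℂ (-(TensorAlgebra.ι ℂ : V →ₗ[ℂ] T V))).toLinearMap

lemma al_one : al (1 : T V) = 1 := by simp [al]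

lemma al_lm (v : V) (x : T V) : al (lm v x) = -lm v (al x) := by
  simp [al, lm_apply]

/-- The action on pairs used to construct the contraction. -/
def pairAct (c : V →ₗ[ℂ] V →ₗ[ℂ] ℂ) :
    V →ₗ[ℂ] Module.End ℂ (T V × (V →ₗ[ℂ] T V)) :=
  LinearMap.mk₂ ℂ
    (fun v xy => (lm v xy.1, (c.flip v).smulRight xy.1 - (lm v).comp xy.2))
    (by
      intro v w x
      ext <;> simp [add_smul, LinearMap.add_comp]
      abel)
    (by
      intro r v x
      ext <;> simp [smul_sub, smul_smul])
    (by
      intro v x y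
      ext <;> simp
      abel)
    (by
      intro r v x
      ext <;> simp [smul_sub, smul_smul, mul_comm])

lemma pairAct_apply (c : V →ₗ[ℂ] V →ₗ[ℂ] ℂ) (v : V) (xy : T V × (V →ₗ[ℂ] T V)) :
    pairAct c v xy = (lm v xy.1, (c.flip v).smulRight xy.1 - (lm v).comp xy.2) := rfl

/-- The contraction. -/
def Dm (c : V →ₗ[ℂ] V →ₗ[ℂ] ℂ) : V →ₗ[ℂ] T V →ₗ[ℂ] T V :=
  ((LinearMap.snd ℂ (T V) (V →ₗ[ℂ] T V)).comp
    ((LinearMap.applyₗ ((1, 0) : T V × (V →ₗ[ℂ] T V))).comp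
      (TensorAlgebra.lift ℂ (pairAct c)).toLinearMap)).flip

lemma Dm_apply (c : V →ₗ[ℂ] V →ₗ[ℂ] ℂ) (u : V) (x : T V) :
    Dm c u x = (TensorAlgebra.lift ℂ (pairAct c) x (1, 0)).2 u := rfl

lemma Dm_one (c : V →ₗ[ℂ] V →ₗ[ℂ] ℂ) (u : V) : Dm c u 1 = 0 := by
  simp [Dm_apply]

lemma pair_fst (c : V →ₗ[ℂ] V →ₗ[ℂ] ℂ) (x : T V) :
    ∀ p, (TensorAlgebra.lift ℂ (pairAct c) x p).1 = x * p.1 := by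
  induction x using TensorAlgebra.induction with
  | algebraMap r => intro p; simp [Algebra.smul_def]
  | ι v => intro p; simp [pairAct_apply, lm_apply]
  | mul a b ha hb => intro p; simp [ha, hb, mul_assoc]
  | add a b ha hb => intro p; simp [ha, hb, add_mul]

lemma Dm_lm (c : V →ₗ[ℂ] V →ₗ[ℂ] ℂ) (u v : V) (x : T V) :
    Dm c u (lm v x) = c u v • x - lm v (Dm c u x) := by
  simp [Dm_apply, lm_apply v x, pairAct_apply, pair_fst]

lemma left_induction {P : T V → Prop} (h1 : P 1)
    (hsmul : ∀ (r : ℂ) x, P x → P (r • x)) (hadd : ∀ x y, P x → P y → P (x + y))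
    (hι : ∀ v x, P x → P (lm v x)) (x : T V) : P x := by
  have key : ∀ y, P y → P (x * y) := by
    induction x using TensorAlgebra.induction with
    | algebraMap r => intro y hy; rw [← Algebra.smul_def]; exact hsmul _ _ hy
    | ι v => intro y hy; exact hι v y hy
    | mul a b ha hb => intro y hy; rw [mul_assoc]; exact ha _ (hb _ hy)
    | add a b ha hb => intro y hy; rw [add_mul]; exact hadd _ _ (ha _ hy) (hb _ hy)
  simpa using key 1 h1

lemma al_al (x : T V) : al (al x) = x := by
  induction x using left_induction with
  | h1 => simp [al_one]
  | hsmul r x h => simp [h]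
  | hadd x y hx hy => simp [hx, hy]
  | hι v x h => simp [al_lm, h]

lemma al_Dm (c : V →ₗ[ℂ] V →ₗ[ℂ] ℂ) (u : V) (x : T V) :
    al (Dm c u x) = -Dm c u (al x) := by
  induction x using left_induction with
  | h1 => simp [al_one, Dm_one]
  | hsmul r x h => simp [h]
  | hadd x y hx hy => simp only [map_add, hx, hy]; abel
  | hι v x h => simp only [Dm_lm, al_lm, map_sub, map_smul, map_neg, h]; abel

open TensorProduct in
/-- The representation on generators. -/
def rho (c : V →ₗ[ℂ] V →ₗ[ℂ] ℂ) (k : V) (pn pp pz pk : V →ₗ[ℂ] V) :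
    V →ₗ[ℂ] Module.End ℂ (N V) where
  toFun u :=
    TensorProduct.map (lm (pn u)) LinearMap.id
    + TensorProduct.map (Dm c u)
        (TensorProduct.map LinearMap.id (TensorProduct.map LinearMap.id (lm k)))
    + TensorProduct.map al (TensorProduct.map (lm (pp u)) LinearMap.id)
    + TensorProduct.map al (TensorProduct.map al (TensorProduct.map (lm (pz u)) LinearMap.id))
    + TensorProduct.map LinearMap.id
        (TensorProduct.map LinearMap.id (TensorProduct.map LinearMap.id (lm (pk u))))
  map_add' u v := by
    simp only [map_add, TensorProduct.map_add_left, TensorProduct.map_add_right]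
    abel
  map_smul' r u := by
    simp only [map_smul, TensorProduct.map_smul_left, TensorProduct.map_smul_right, smul_add,
      RingHom.id_apply]

lemma rho_tmul (c : V →ₗ[ℂ] V →ₗ[ℂ] ℂ) (k : V) (pn pp pz pk : V →ₗ[ℂ] V) (u : V)
    (x y z w : T V) :
    rho c k pn pp pz pk u (x ⊗ₜ (y ⊗ₜ (z ⊗ₜ w))) =
      lm (pn u) x ⊗ₜ (y ⊗ₜ (z ⊗ₜ w)) + Dm c u x ⊗ₜ (y ⊗ₜ (z ⊗ₜ lm k w))
      + al x ⊗ₜ (lm (pp u) y ⊗ₜ (z ⊗ₜ w)) + al x ⊗ₜ (al y ⊗ₜ (lm (pz u) z ⊗ₜ w))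
      + x ⊗ₜ (y ⊗ₜ (z ⊗ₜ lm (pk u) w)) := rfl

lemma End_ext {f g : Module.End ℂ (N V)}
    (h : ∀ x y z w : T V, f (x ⊗ₜ (y ⊗ₜ (z ⊗ₜ w))) = g (x ⊗ₜ (y ⊗ₜ (z ⊗ₜ w)))) : f = g := by
  ext x y z w
  exact h x y z w

/-- Multiplying out. -/
def mulOut : N V →ₗ[ℂ] T V :=
  (LinearMap.mul' ℂ (T V)).comp (TensorProduct.map LinearMap.id
    ((LinearMap.mul' ℂ (T V)).comp (TensorProduct.map LinearMap.id (LinearMap.mul' ℂ (T V)))))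

lemma mulOut_tmul (x y z w : T V) : mulOut (x ⊗ₜ (y ⊗ₜ (z ⊗ₜ w))) = x * (y * (z * w)) := rfl

variable (c : V →ₗ[ℂ] V →ₗ[ℂ] ℂ) (k : V) (pn pp pz pk : V →ₗ[ℂ] V)

/-- The action on a negative element. -/
lemma rho_neg {u : V} (h1 : pn u = u) (h2 : pp u = 0) (h3 : pz u = 0) (h4 : pk u = 0)
    (h5 : ∀ v, c u v = 0) (x y z w : T V) :
    rho c k pn pp pz pk u (x ⊗ₜ (y ⊗ₜ (z ⊗ₜ w))) = lm u x ⊗ₜ (y ⊗ₜ (z ⊗ₜ w)) := by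
  have hD : ∀ x, Dm c u x = 0 := by
    intro x
    induction x using left_induction with
    | h1 => simp [Dm_one]
    | hsmul r x h => simp [h]
    | hadd x y hx hy => simp [hx, hy]
    | hι v x h => simp [Dm_lm, h, h5]
  simp [rho_tmul, h1, h2, h3, h4, hD]

lemma rho_pos {u : V} (h1 : pn u = 0) (h2 : pp u = u) (h3 : pz u = 0) (h4 : pk u = 0)
    (x y z w : T V) :
    rho c k pn pp pz pk u (x ⊗ₜ (y ⊗ₜ (z ⊗ₜ w))) =
      Dm c u x ⊗ₜ (y ⊗ₜ (z ⊗ₜ lm k w)) + al x ⊗ₜ (lm u y ⊗ₜ (z ⊗ₜ w)) := by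
  simp [rho_tmul, h1, h2, h3, h4]

lemma rho_zero {u : V} (h1 : pn u = 0) (h2 : pp u = 0) (h3 : pz u = u) (h4 : pk u = 0)
    (h5 : ∀ v, c u v = 0) (x y z w : T V) :
    rho c k pn pp pz pk u (x ⊗ₜ (y ⊗ₜ (z ⊗ₜ w))) =
      al x ⊗ₜ (al y ⊗ₜ (lm u z ⊗ₜ w)) := by
  have hD : ∀ x, Dm c u x = 0 := by
    intro x
    induction x using left_induction with
    | h1 => simp [Dm_one]
    | hsmul r x h => simp [h]
    | hadd x y hx hy => simp [hx, hy]
    | hι v x h => simp [Dm_lm, h, h5]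
  simp [rho_tmul, h1, h2, h3, h4, hD]

lemma rho_kk {u : V} (h1 : pn u = 0) (h2 : pp u = 0) (h3 : pz u = 0) (h4 : pk u = u)
    (h5 : ∀ v, c u v = 0) (x y z w : T V) :
    rho c k pn pp pz pk u (x ⊗ₜ (y ⊗ₜ (z ⊗ₜ w))) =
      x ⊗ₜ (y ⊗ₜ (z ⊗ₜ lm u w)) := by
  have hD : ∀ x, Dm c u x = 0 := by
    intro x
    induction x using left_induction with
    | h1 => simp [Dm_one]
    | hsmul r x h => simp [h]
    | hadd x y hx hy => simp [hx, hy]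
    | hι v x h => simp [Dm_lm, h, h5]
  simp [rho_tmul, h1, h2, h3, h4, hD]

end abstractPart

section concrete

variable {M : ℕ}

/-- Linear extension from the Laurent monomials. -/
def lext {W : Type} [AddCommGroup W] [Module ℂ W] (f : ℤ → W) : LaurentPolynomial ℂ →ₗ[ℂ] W :=
  (AddMonoidAlgebra.basis ℤ ℂ).constr ℂ f

lemma lext_T {W : Type} [AddCommGroup W] [Module ℂ W] (f : ℤ → W) (n : ℤ) :
    lext f (LaurentPolynomial.T n) = f n := by
  have : (LaurentPolynomial.T n : LaurentPolynomial ℂ) = AddMonoidAlgebra.basis ℤ ℂ n := by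
    rw [AddMonoidAlgebra.basis_apply]; rfl
  rw [this, lext, Module.Basis.constr_basis]

/-- Projection to the modes with index in `s`. -/
def proj (M : ℕ) (s : ℤ → Prop) [DecidablePred s] : Hhat M →ₗ[ℂ] Hhat M :=
  (LinearMap.inl ℂ _ _).comp ((LinearMap.lTensor (hSp M)
    (lext fun n => if s n then LaurentPolynomial.T n else 0)).comp (LinearMap.fst ℂ _ _))

lemma proj_mode (s : ℤ → Prop) [DecidablePred s] (a : hSp M) (n : ℤ) :
    proj M s (mode a n) = if s n then mode a n else 0 := by
  unfold proj mode
  simp only [LinearMap.comp_apply, LinearMap.fst_apply, LinearMap.lTensor_tmul, lext_T]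
  split_ifs <;> simp

lemma proj_kk (s : ℤ → Prop) [DecidablePred s] : proj M s (kk M) = 0 := by
  simp [proj, kk]

/-- Projection to the central line. -/
def projk (M : ℕ) : Hhat M →ₗ[ℂ] Hhat M := (LinearMap.inr ℂ _ _).comp (LinearMap.snd ℂ _ _)

lemma projk_mode (a : hSp M) (n : ℤ) : projk M (mode a n) = 0 := by
  simp [projk, mode]

lemma projk_kk : projk M (kk M) = kk M := by
  simp [projk, kk]

/-- The contraction coefficients. -/
def gam : LaurentPolynomial ℂ →ₗ[ℂ] LaurentPolynomial ℂ →ₗ[ℂ] ℂ :=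
  lext fun m => lext fun n => if 0 < m ∧ m + n = 0 then (m : ℂ) else 0

/-- The contraction form. -/
def cc (B : hSp M →ₗ[ℂ] hSp M →ₗ[ℂ] ℂ) : Hhat M →ₗ[ℂ] Hhat M →ₗ[ℂ] ℂ :=
  ((TensorProduct.map₂ B gam).compr₂ (TensorProduct.lid ℂ ℂ).toLinearMap).compl₁₂
    (LinearMap.fst ℂ _ _) (LinearMap.fst ℂ _ _)

lemma cc_mode (B : hSp M →ₗ[ℂ] hSp M →ₗ[ℂ] ℂ) (a b : hSp M) (m n : ℤ) :
    cc B (mode a m) (mode b n) = B a b * if 0 < m ∧ m + n = 0 then (m : ℂ) else 0 := by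
  simp [cc, mode, gam, lext_T]

lemma cc_kk_left (B : hSp M →ₗ[ℂ] hSp M →ₗ[ℂ] ℂ) (v : Hhat M) : cc B (kk M) v = 0 := by
  simp [cc, kk]

lemma cc_nonpos (B : hSp M →ₗ[ℂ] hSp M →ₗ[ℂ] ℂ) (a : hSp M) (m : ℤ) (hm : m ≤ 0)
    (v : Hhat M) : cc B (mode a m) v = 0 := by
  have hg : gam (LaurentPolynomial.T m) = 0 := by
    rw [gam, lext_T]
    apply (AddMonoidAlgebra.basis ℤ ℂ).ext
    intro i
    rw [lext, Module.Basis.constr_basis, if_neg (by omega)]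
    simp
  have : TensorProduct.map₂ B gam (a ⊗ₜ[ℂ] LaurentPolynomial.T m) = 0 := by
    ext
    simp [hg]
  simp [cc, mode, this]

/-- The representation. -/
def R (B : hSp M →ₗ[ℂ] hSp M →ₗ[ℂ] ℂ) : Hhat M →ₗ[ℂ] Module.End ℂ (N (Hhat M)) :=
  rho (cc B) (kk M) (proj M (· < 0)) (proj M (0 < ·)) (proj M (· = 0)) (projk M)

variable (B : hSp M →ₗ[ℂ] hSp M →ₗ[ℂ] ℂ)

lemma R_neg (a : hSp M) (n : ℤ) (hn : n < 0) (x y z w : TA M) :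
    R B (mode a n) (x ⊗ₜ (y ⊗ₜ (z ⊗ₜ w))) = lm (mode a n) x ⊗ₜ (y ⊗ₜ (z ⊗ₜ w)) := by
  apply rho_neg
  · rw [proj_mode, if_pos hn]
  · rw [proj_mode, if_neg (by omega)]
  · rw [proj_mode, if_neg (by omega)]
  · exact projk_mode _ _
  · exact cc_nonpos B a n hn.le

lemma R_pos (a : hSp M) (n : ℤ) (hn : 0 < n) (x y z w : TA M) :
    R B (mode a n) (x ⊗ₜ (y ⊗ₜ (z ⊗ₜ w))) =
      Dm (cc B) (mode a n) x ⊗ₜ (y ⊗ₜ (z ⊗ₜ lm (kk M) w))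
        + al x ⊗ₜ (lm (mode a n) y ⊗ₜ (z ⊗ₜ w)) := by
  apply rho_pos
  · rw [proj_mode, if_neg (by omega)]
  · rw [proj_mode, if_pos hn]
  · rw [proj_mode, if_neg (by omega)]
  · exact projk_mode _ _

lemma R_zero (a : hSp M) (x y z w : TA M) :
    R B (mode a 0) (x ⊗ₜ (y ⊗ₜ (z ⊗ₜ w))) =
      al x ⊗ₜ (al y ⊗ₜ (lm (mode a 0) z ⊗ₜ w)) := by
  apply rho_zero
  · rw [proj_mode, if_neg (by omega)]
  · rw [proj_mode, if_neg (by omega)]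
  · rw [proj_mode, if_pos rfl]
  · exact projk_mode _ _
  · exact cc_nonpos B a 0 le_rfl

lemma R_kk (x y z w : TA M) :
    R B (kk M) (x ⊗ₜ (y ⊗ₜ (z ⊗ₜ w))) = x ⊗ₜ (y ⊗ₜ (z ⊗ₜ lm (kk M) w)) := by
  apply rho_kk
  · exact proj_kk _
  · exact proj_kk _
  · exact proj_kk _
  · exact projk_kk
  · exact cc_kk_left B

lemma rel1 (a b : hSp M) (m n : ℤ) (hm : 0 < m) (hn : n < 0) :
    R B (mode a m) * R B (mode b n) + R B (mode b n) * R B (mode a m)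
      - (if m + n = 0 then (m : ℂ) * B a b else 0) • R B (kk M) = 0 := by
  have hc : (if m + n = 0 then (m : ℂ) * B a b else 0) = cc B (mode a m) (mode b n) := by
    rw [cc_mode]
    split_ifs <;> simp_all [mul_comm]
  rw [hc]
  apply End_ext
  intro x y z w
  simp only [LinearMap.sub_apply, LinearMap.add_apply, Module.End.mul_apply, LinearMap.smul_apply,
    R_neg B b n hn, R_pos B a m hm, R_kk, map_add, Dm_lm, al_lm, TensorProduct.sub_tmul,
    TensorProduct.neg_tmul, LinearMap.zero_apply, TensorProduct.smul_tmul']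
  abel

lemma rel2 (a b : hSp M) (p : ℤ) (hp : p ≠ 0) :
    R B (mode a p) * R B (mode b 0) + R B (mode b 0) * R B (mode a p) = 0 := by
  apply End_ext
  intro x y z w
  rcases lt_or_gt_of_ne hp with h | h
  · simp only [LinearMap.add_apply, Module.End.mul_apply, R_neg B a p h, R_zero, al_lm,
      TensorProduct.neg_tmul, LinearMap.zero_apply]
    abel
  · simp only [LinearMap.add_apply, Module.End.mul_apply, R_pos B a p h, R_zero, al_lm, map_add,
      al_al, al_Dm, TensorProduct.neg_tmul, TensorProduct.tmul_neg, LinearMap.zero_apply]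
    abel

lemma rel3 (a : hSp M) (q : ℤ) :
    R B (mode a q) * R B (kk M) - R B (kk M) * R B (mode a q) = 0 := by
  apply End_ext
  intro x y z w
  rcases lt_trichotomy q 0 with h | h | h
  · simp [R_neg B a q h, R_kk]
  · subst h
    simp [R_zero, R_kk]
  · simp [R_pos B a q h, R_kk]

/-- The algebra representation. -/
def Phi : TA M →ₐ[ℂ] Module.End ℂ (N (Hhat M)) := TensorAlgebra.lift ℂ (R B)

lemma Phi_ι (v : Hhat M) : Phi B (ιT v) = R B v := by
  simp [Phi, ιT]

/-- The retraction. -/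
def LL : TA M →ₗ[ℂ] TA M :=
  mulOut.comp ((LinearMap.applyₗ ((1 : TA M) ⊗ₜ[ℂ] ((1 : TA M) ⊗ₜ[ℂ]
    ((1 : TA M) ⊗ₜ[ℂ] (1 : TA M))) : N (Hhat M))).comp (Phi B).toLinearMap)

lemma LL_apply (x : TA M) : LL B x = mulOut (Phi B x (1 ⊗ₜ (1 ⊗ₜ (1 ⊗ₜ 1)))) := rfl

lemma LL_J (x : TA M) (hx : x ∈ Jsub M B) : LL B x = 0 := by
  have : Jsub M B ≤ LinearMap.ker (LL B) := by
    rw [Jsub, Submodule.span_le]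
    rintro _ ⟨a, g, b, hg, rfl⟩
    have hg0 : Phi B g = 0 := by
      rcases hg with (⟨a, b, m, n, hm, hn, rfl⟩ | ⟨a, b, p, hp, rfl⟩) | ⟨a, q, rfl⟩
      · simp only [map_sub, map_add, map_mul, map_smul, Phi_ι]
        exact rel1 B a b m n hm hn
      · simp only [map_add, map_mul, Phi_ι]
        exact rel2 B a b p hp
      · simp only [map_sub, map_mul, Phi_ι]
        exact rel3 B a q
    simp [LL_apply, hg0]
  exact this hx

lemma Phi_k (q : ℕ) (x y z w : TA M) :
    Phi B (ιT (kk M) ^ q) (x ⊗ₜ (y ⊗ₜ (z ⊗ₜ w))) =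
      x ⊗ₜ (y ⊗ₜ (z ⊗ₜ (ιT (kk M) ^ q * w))) := by
  induction q generalizing w with
  | zero => simp
  | succ q ih =>
    rw [pow_succ, map_mul, Module.End.mul_apply, Phi_ι, R_kk, ih, mul_assoc]
    rfl

lemma Phi_z (l : List (TA M)) (hl : ∀ t ∈ l, ∃ a, t = ιT (mode a 0)) (w : TA M) :
    Phi B l.prod (1 ⊗ₜ (1 ⊗ₜ (1 ⊗ₜ w))) = 1 ⊗ₜ (1 ⊗ₜ (l.prod ⊗ₜ w)) := by
  induction l with
  | nil => simp
  | cons t l ih =>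
    obtain ⟨a, rfl⟩ := hl t (by simp)
    rw [List.prod_cons, map_mul, Module.End.mul_apply, ih fun t ht => hl t (by simp [ht]),
      Phi_ι, R_zero, al_one]
    rfl

lemma Phi_p (l : List (TA M)) (hl : ∀ t ∈ l, ∃ a n, 0 < n ∧ t = ιT (mode a n)) (z w : TA M) :
    Phi B l.prod (1 ⊗ₜ (1 ⊗ₜ (z ⊗ₜ w))) = 1 ⊗ₜ (l.prod ⊗ₜ (z ⊗ₜ w)) := by
  induction l with
  | nil => simp
  | cons t l ih =>
    obtain ⟨a, n, hn, rfl⟩ := hl t (by simp)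
    rw [List.prod_cons, map_mul, Module.End.mul_apply, ih fun t ht => hl t (by simp [ht]),
      Phi_ι, R_pos B a n hn, al_one, Dm_one, TensorProduct.zero_tmul, zero_add]
    rfl

lemma Phi_n (l : List (TA M)) (hl : ∀ t ∈ l, ∃ a n, n < 0 ∧ t = ιT (mode a n)) (y z w : TA M) :
    Phi B l.prod (1 ⊗ₜ (y ⊗ₜ (z ⊗ₜ w))) = l.prod ⊗ₜ (y ⊗ₜ (z ⊗ₜ w)) := by
  induction l with
  | nil => simp
  | cons t l ih =>
    obtain ⟨a, n, hn, rfl⟩ := hl t (by simp)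
    rw [List.prod_cons, map_mul, Module.End.mul_apply, ih fun t ht => hl t (by simp [ht]),
      Phi_ι, R_neg B a n hn]
    rfl

lemma LL_S (x : TA M) (hx : x ∈ Ssub M) : LL B x = x := by
  have : Ssub M ≤ LinearMap.eqLocus (LL B) LinearMap.id := by
    rw [Ssub, Submodule.span_le]
    rintro _ ⟨j, l, p, q, hn, mn, hp, np, hz, h1, h2, rfl⟩
    simp only [SetLike.mem_coe, LinearMap.mem_eqLocus, LinearMap.id_apply]
    rw [LL_apply, map_mul, map_mul, map_mul, Module.End.mul_apply, Module.End.mul_apply,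
      Module.End.mul_apply, Phi_k, Phi_z, Phi_p, Phi_n, mulOut_tmul, mul_one]
    · simp only [mul_assoc]
    · intro t ht
      obtain ⟨i, rfl⟩ := (List.mem_ofFn' _ _).1 ht
      exact ⟨hn i, _, by have := h1 i; omega, rfl⟩
    · intro t ht
      obtain ⟨i, rfl⟩ := (List.mem_ofFn' _ _).1 ht
      exact ⟨hp i, _, by have := h2 i; omega, rfl⟩
    · intro t ht
      obtain ⟨i, rfl⟩ := (List.mem_ofFn' _ _).1 ht
      exact ⟨hz i, rfl⟩
  exact this hx

end concrete

end Retr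

/-- There exists a linear map `L : T(ĥ_ℤ) → T(ĥ_ℤ)` vanishing on the ideal `J`
and restricting to the identity on the subspace `S` of ordered monomials;
consequently `S ∩ J = 0`, i.e. the sum `T(ĥ_ℤ) = S + J` is direct. -/
theorem exists_retraction_killing_ideal (M : ℕ) (B : hSp M →ₗ[ℂ] hSp M →ₗ[ℂ] ℂ)
    (hsymm : ∀ a b, B a b = B b a)
    (hnd : ∀ a : hSp M, (∀ b : hSp M, B a b = 0) → a = 0) :
    (∃ L : TA M →ₗ[ℂ] TA M,
      (∀ x ∈ Jsub M B, L x = 0) ∧ (∀ x ∈ Ssub M, L x = x)) ∧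
    (∀ x : TA M, x ∈ Ssub M → x ∈ Jsub M B → x = 0) := by
  refine ⟨⟨Retr.LL B, Retr.LL_J B, Retr.LL_S B⟩, fun x hS hJ => ?_⟩
  rw [← Retr.LL_S B x hS, Retr.LL_J B x hJ]

end
end

section
/- For every r ≥ 1 and all a₁, …, a_r ∈ H, the normal ordering of zero modes admits the recursion from the right: :a₁(0)⋯a_r(0): = :a₁(0)⋯a_{r−1}(0):·φ(a_r) + ∑_{i=1}^{r−1} ((−1)^{i+r}/2)·(a_i, a_r)·:a₁(0)⋯â_i(0)⋯a_{r−1}(0):, where the hat denotes omission of the i-th factor. -/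
noncomputable section

open Finset

variable {H A : Type*}

/-- The normal ordering `:a₁(0)⋯a_r(0):` of zero modes, defined recursively
(from the left) by `:(empty): = 1` and
`:a₁(0)⋯a_r(0): = φ(a₁)·:a₂(0)⋯a_r(0): +
  ∑_{i=2}^{r} ((−1)^{i+1}/2)·(a₁,a_i)·:a₂(0)⋯â_i(0)⋯a_r(0):`
(in the 0-based index `j` of the tail, `i = j + 2`, so the sign is
`(−1)^{j+1}`). -/
def nord [AddCommGroup H] [Module ℂ H] [Ring A] [Algebra ℂ A]
    (B : H →ₗ[ℂ] H →ₗ[ℂ] ℂ) (φ : H →ₗ[ℂ] A) : List H → A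
  | [] => 1
  | a :: l => φ a * nord B φ l +
      ∑ j : Fin l.length,
        (((-1 : ℂ) ^ (j.val + 1) / 2) * B a (l.get j)) • nord B φ (l.eraseIdx j.val)
  termination_by l => l.length
  decreasing_by
  · simp
  · have := List.length_eraseIdx_le l j.val
    simp only [List.length_cons]
    omega

theorem nordAux_erase_comm (m : List H) (j k : ℕ) (h : j ≤ k) :
    (m.eraseIdx j).eraseIdx k = (m.eraseIdx (k + 1)).eraseIdx j := by
  apply List.ext_getElem?
  intro i
  simp only [List.getElem?_eraseIdx]
  grind

theorem nordAux_fin_sum [AddCommGroup H] [AddCommGroup A] (l : List H)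
    (F : ℕ → H → A) :
    ∑ j : Fin l.length, F j.val (l.get j) =
      ∑ j ∈ Finset.range l.length, F j (l[j]?.getD 0) := by
  rw [← Fin.sum_univ_eq_sum_range (fun j => F j (l[j]?.getD 0))]
  apply Finset.sum_congr rfl
  intro j _
  simp

theorem nordAux_cons [AddCommGroup H] [Module ℂ H] [Ring A] [Algebra ℂ A]
    (B : H →ₗ[ℂ] H →ₗ[ℂ] ℂ) (φ : H →ₗ[ℂ] A) (b : H) (l : List H) :
    nord B φ (b :: l) = φ b * nord B φ l +
      ∑ j ∈ Finset.range l.length,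
        (((-1 : ℂ) ^ (j + 1) / 2) * B b (l[j]?.getD 0)) • nord B φ (l.eraseIdx j) := by
  rw [nord, nordAux_fin_sum l
    (fun j x => (((-1 : ℂ) ^ (j + 1) / 2) * B b x) • nord B φ (l.eraseIdx j))]

theorem nordAux_double [AddCommGroup H] [Module ℂ H] [Ring A] [Algebra ℂ A]
    (B : H →ₗ[ℂ] H →ₗ[ℂ] ℂ) (φ : H →ₗ[ℂ] A) (a b : H) (m : List H) (n : ℕ) :
    ∑ j ∈ Finset.range (n + 1), ∑ k ∈ Finset.range n,
      ((((-1 : ℂ) ^ (j + 1) / 2) * B b (m[j]?.getD 0)) *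
        (((-1 : ℂ) ^ (k + n) / 2) * B ((m.eraseIdx j)[k]?.getD 0) a)) •
          nord B φ ((m.eraseIdx j).eraseIdx k) =
    ∑ j ∈ Finset.range (n + 1), ∑ k ∈ Finset.range n,
      ((((-1 : ℂ) ^ (j + 1 + (n + 2)) / 2) * B (m[j]?.getD 0) a) *
        (((-1 : ℂ) ^ (k + 1) / 2) * B b ((m.eraseIdx j)[k]?.getD 0))) •
          nord B φ ((m.eraseIdx j).eraseIdx k) := by
  rw [← Finset.sum_product', ← Finset.sum_product']
  have hinv : ∀ x : ℕ × ℕ, (fun p : ℕ × ℕ => if p.1 ≤ p.2 then (p.2 + 1, p.1) else (p.2, p.1 - 1))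
      ((fun p : ℕ × ℕ => if p.1 ≤ p.2 then (p.2 + 1, p.1) else (p.2, p.1 - 1)) x) = x := by
    rintro ⟨j, k⟩
    by_cases h : j ≤ k
    · simp [h]
    · have h2 : k ≤ j - 1 := by omega
      have h3 : j - 1 + 1 = j := by omega
      simp [h, h2, h3]
  have hmem : ∀ x ∈ Finset.range (n + 1) ×ˢ Finset.range n,
      (fun p : ℕ × ℕ => if p.1 ≤ p.2 then (p.2 + 1, p.1) else (p.2, p.1 - 1)) x ∈
        Finset.range (n + 1) ×ˢ Finset.range n := by
    rintro ⟨j, k⟩ hx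
    simp only [Finset.mem_product, Finset.mem_range] at hx
    by_cases h : j ≤ k
    · simp only [h, if_true, Finset.mem_product, Finset.mem_range]
      omega
    · simp only [h, if_false, Finset.mem_product, Finset.mem_range]
      omega
  refine Finset.sum_nbij' _ _ hmem hmem (fun x _ => hinv x) (fun x _ => hinv x) ?_
  rintro ⟨j, k⟩ hx
  by_cases h : j ≤ k
  · have e1 : (m.eraseIdx j)[k]? = m[k + 1]? := by
      rw [List.getElem?_eraseIdx, if_neg (by omega)]
    have e2 : (m.eraseIdx (k + 1))[j]? = m[j]? := by
      rw [List.getElem?_eraseIdx, if_pos (by omega)]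
    simp only [h, if_true, e1, e2, nordAux_erase_comm m j k h]
    congr 1
    ring
  · obtain ⟨i, rfl⟩ : ∃ i, j = i + 1 := ⟨j - 1, by omega⟩
    have h' : k ≤ i := by omega
    have e1 : (m.eraseIdx (i + 1))[k]? = m[k]? := by
      rw [List.getElem?_eraseIdx, if_pos (by omega)]
    have e2 : (m.eraseIdx k)[i]? = m[i + 1]? := by
      rw [List.getElem?_eraseIdx, if_neg (by omega)]
    simp only [h, if_false, Nat.add_sub_cancel, e1, e2, nordAux_erase_comm m k i h']
    congr 1
    ring

theorem nordAux_right [AddCommGroup H] [Module ℂ H] [Ring A] [Algebra ℂ A]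
    (B : H →ₗ[ℂ] H →ₗ[ℂ] ℂ) (φ : H →ₗ[ℂ] A) (a : H) (N : ℕ) :
    ∀ l : List H, l.length = N →
    nord B φ (l ++ [a]) = nord B φ l * φ a +
      ∑ j ∈ Finset.range l.length,
        (((-1 : ℂ) ^ (j + l.length) / 2) * B (l[j]?.getD 0) a) • nord B φ (l.eraseIdx j) := by
  induction N using Nat.strong_induction_on with
  | _ N ih =>
  intro l hl
  match l, hl with
  | [], _ => simp [nordAux_cons, nord]
  | [b], _ => simp [nordAux_cons, nord]
  | b :: c :: m', hl =>
    obtain ⟨m, hm⟩ : ∃ m, m = c :: m' := ⟨_, rfl⟩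
    obtain ⟨n, hn⟩ : ∃ n, m.length = n + 1 := ⟨m'.length, by simp [hm]⟩
    rw [← hm] at hl ⊢
    have hN : N = n + 2 := by rw [← hl]; simp [hn]
    have er : ∀ j ∈ Finset.range (n + 1), (m.eraseIdx j).length = n := by
      intro j hj
      rw [Finset.mem_range] at hj
      rw [List.length_eraseIdx_of_lt (by omega)]; omega
    have L : ∑ j ∈ Finset.range (n + 1),
        (((-1 : ℂ) ^ (j + 1) / 2) * B b ((m ++ [a])[j]?.getD 0)) •
          nord B φ ((m ++ [a]).eraseIdx j) =
        ∑ j ∈ Finset.range (n + 1),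
          ((((-1 : ℂ) ^ (j + 1) / 2) * B b (m[j]?.getD 0)) •
            nord B φ (m.eraseIdx j)) * φ a +
        ∑ j ∈ Finset.range (n + 1), ∑ k ∈ Finset.range n,
      ((((-1 : ℂ) ^ (j + 1) / 2) * B b (m[j]?.getD 0)) *
        (((-1 : ℂ) ^ (k + n) / 2) * B ((m.eraseIdx j)[k]?.getD 0) a)) •
          nord B φ ((m.eraseIdx j).eraseIdx k) := by
      rw [← Finset.sum_add_distrib]
      apply Finset.sum_congr rfl
      intro j hj
      have hj' := Finset.mem_range.1 hj
      rw [List.getElem?_append_left (by omega), List.eraseIdx_append_of_lt_length (by omega),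
        ih n (by omega) _ (er j hj), er j hj, smul_add, Finset.smul_sum, smul_mul_assoc]
      simp only [smul_smul]
    have R : ∑ j ∈ Finset.range (n + 1),
        (((-1 : ℂ) ^ (j + 1 + (n + 2)) / 2) * B (m[j]?.getD 0) a) •
          nord B φ (b :: m.eraseIdx j) =
        φ b * ∑ j ∈ Finset.range (n + 1),
          (((-1 : ℂ) ^ (j + (n + 1)) / 2) * B (m[j]?.getD 0) a) • nord B φ (m.eraseIdx j) +
        ∑ j ∈ Finset.range (n + 1), ∑ k ∈ Finset.range n,
      ((((-1 : ℂ) ^ (j + 1 + (n + 2)) / 2) * B (m[j]?.getD 0) a) *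
        (((-1 : ℂ) ^ (k + 1) / 2) * B b ((m.eraseIdx j)[k]?.getD 0))) •
          nord B φ ((m.eraseIdx j).eraseIdx k) := by
      rw [Finset.mul_sum, ← Finset.sum_add_distrib]
      apply Finset.sum_congr rfl
      intro j hj
      rw [nordAux_cons, er j hj, smul_add, Finset.smul_sum, mul_smul_comm]
      simp only [smul_smul]
      congr 2
      ring
    have E : (m ++ [a]).eraseIdx (n + 1) = m := by
      rw [List.eraseIdx_append_of_length_le (by omega)]; simp [hn]
    have G : (m ++ [a])[n + 1]? = some a := by
      rw [← hn]; simp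
    rw [List.cons_append, nordAux_cons, List.length_append, hn, List.length_singleton,
      Finset.sum_range_succ, L, E, G, ih (n + 1) (by omega) m hn, nordAux_cons, List.length_cons,
      hn, Finset.sum_range_succ' _ (n + 1)]
    simp only [List.getElem?_cons_succ, List.eraseIdx_cons_succ, List.getElem?_cons_zero,
      List.eraseIdx_cons_zero, Option.getD_some]
    rw [R, nordAux_double, add_mul, Finset.sum_mul, mul_add, mul_assoc]
    have S : (-1 : ℂ) ^ (0 + (n + 1 + 1)) = (-1 : ℂ) ^ (n + 1 + 1) := by rw [zero_add]
    rw [S]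
    abel

/-- The normal ordering of zero modes admits a recursion from the right:
`:a₁(0)⋯a_r(0): = :a₁(0)⋯a_{r−1}(0):·φ(a_r) +
  ∑_{i=1}^{r−1} ((−1)^{i+r}/2)·(a_i,a_r)·:a₁(0)⋯â_i(0)⋯a_{r−1}(0):`.
Here `r ≥ 1`, the list of the first `r − 1` arguments is `l` and the last
argument is `a`; in the 0-based index `j` of `l` we have `i = j + 1` and
`r = l.length + 1`, so the sign `(−1)^{i+r}` is `(−1)^{j+l.length}`. -/
theorem nord_recursion_from_right [AddCommGroup H] [Module ℂ H] [Ring A] [Algebra ℂ A]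
    (B : H →ₗ[ℂ] H →ₗ[ℂ] ℂ) (hB : ∀ a b, B a b = B b a) (φ : H →ₗ[ℂ] A)
    (l : List H) (a : H) :
    nord B φ (l ++ [a]) = nord B φ l * φ a +
      ∑ j : Fin l.length,
        (((-1 : ℂ) ^ (j.val + l.length) / 2) * B (l.get j) a) • nord B φ (l.eraseIdx j.val) := by
  rw [nordAux_right B φ a _ l rfl, nordAux_fin_sum l
    (fun j x => (((-1 : ℂ) ^ (j + l.length) / 2) * B x a) • nord B φ (l.eraseIdx j))]

end
end

section
/- Suppose μ ≥ 1. Then ∑_{σ ∈ J_{μ,ν}(1,…,r)} ∑_{i=1}^{μ} (−1)^{i−1}·(−1)^{σ}·Φ(σ(1), …, σ(i)̂, …, σ(r))·Ψ(σ(i)) = ∑_{j=1}^{r} (−1)^{j−1}·Ψ(j)·∑_{τ ∈ J_{μ−1,ν}(1,…,ĵ,…,r)} (−1)^{τ}·Φ(τ(1), …, τ(r−1)), where σ(i)̂ means the i-th entry is omitted from the tuple (σ(1),…,σ(r)). -/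
open Finset

/-- `σ` is a 3-shuffle with block sizes `μ`, `ν`, `r − μ − ν`: it is strictly
increasing on the first `μ` positions, on the next `ν` positions, and on the
remaining positions. -/
def IsShuffle3 {r : ℕ} (μ ν : ℕ) (σ : Equiv.Perm (Fin r)) : Prop :=
  (∀ i j : Fin r, i < j → j.val < μ → σ i < σ j) ∧
  (∀ i j : Fin r, i < j → μ ≤ i.val → j.val < μ + ν → σ i < σ j) ∧
  (∀ i j : Fin r, i < j → μ + ν ≤ i.val → σ i < σ j)

/-- Extend `τ` to a permutation sending `i` to `j`. -/
def shuffleExt {n : ℕ} (i j : Fin (n + 1)) (τ : Equiv.Perm (Fin n)) : Equiv.Perm (Fin (n + 1)) :=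
  (Fin.cycleRange j).symm * Equiv.Perm.decomposeFin.symm (0, τ) * Fin.cycleRange i

theorem shuffleExt_self {n : ℕ} (i j : Fin (n + 1)) (τ : Equiv.Perm (Fin n)) :
    shuffleExt i j τ i = j := by
  simp [shuffleExt]

theorem shuffleExt_succAbove {n : ℕ} (i j : Fin (n + 1)) (τ : Equiv.Perm (Fin n)) (t : Fin n) :
    shuffleExt i j τ (i.succAbove t) = j.succAbove (τ t) := by
  have h : Fin.cycleRange i (i.succAbove t) = t.succ := by
    rw [← Fin.cycleRange_symm_succ, Equiv.apply_symm_apply]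
  simp [shuffleExt, h]

theorem shuffleExt_sign {n : ℕ} (i j : Fin (n + 1)) (τ : Equiv.Perm (Fin n)) :
    Equiv.Perm.sign (shuffleExt i j τ)
      = (-1) ^ j.val * Equiv.Perm.sign τ * (-1) ^ i.val := by
  simp [shuffleExt, Equiv.Perm.sign_mul, Fin.sign_cycleRange, Equiv.Perm.decomposeFin.symm_sign]

theorem shuffleExt_bijective {n : ℕ} (i : Fin (n + 1)) :
    Function.Bijective (fun p : Fin (n + 1) × Equiv.Perm (Fin n) => shuffleExt i p.1 p.2) := by
  rw [Fintype.bijective_iff_injective_and_card]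
  constructor
  · rintro ⟨j, τ⟩ ⟨j', τ'⟩ h
    simp only at h
    have hj : j = j' := by
      rw [← shuffleExt_self i j τ, h, shuffleExt_self]
    subst hj
    have : τ = τ' := by
      ext t : 1
      have h2 := shuffleExt_succAbove i j τ t
      rw [h, shuffleExt_succAbove] at h2
      exact (Fin.succAbove_right_injective h2).symm
    rw [this]
  · simp [Fintype.card_perm, Nat.factorial_succ]

theorem succAbove_val_cases {n : ℕ} (i : Fin (n + 1)) (t : Fin n) :
    (t.val < i.val ∧ (i.succAbove t).val = t.val) ∨
    (i.val ≤ t.val ∧ (i.succAbove t).val = t.val + 1) := by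
  rcases lt_or_ge t.val i.val with h | h
  · left
    exact ⟨h, by rw [Fin.succAbove_of_castSucc_lt _ _ (by simpa [Fin.lt_def] using h)]; simp⟩
  · right
    exact ⟨h, by rw [Fin.succAbove_of_le_castSucc _ _ (by simpa [Fin.le_def] using h)]; simp⟩

theorem shuffleExt_iff {n μ ν : ℕ} (hμ : 1 ≤ μ) (i j : Fin (n + 1)) (hi : i.val < μ)
    (τ : Equiv.Perm (Fin n)) :
    IsShuffle3 μ ν (shuffleExt i j τ) ↔
      IsShuffle3 (μ - 1) ν τ ∧
        ∀ t : Fin n, t.val < μ - 1 → (t.val < i.val ↔ (τ t).val < j.val) := by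
  constructor
  · rintro ⟨h1, h2, h3⟩
    refine ⟨⟨?_, ?_, ?_⟩, ?_⟩
    · intro a b hab hb
      have h := h1 (i.succAbove a) (i.succAbove b) (Fin.succAbove_lt_succAbove_iff.2 hab)
        (by have := succAbove_val_cases i b; omega)
      simpa [shuffleExt_succAbove] using h
    · intro a b hab ha hb
      have h := h2 (i.succAbove a) (i.succAbove b) (Fin.succAbove_lt_succAbove_iff.2 hab)
        (by have := succAbove_val_cases i a; omega)
        (by have := succAbove_val_cases i b; omega)
      simpa [shuffleExt_succAbove] using h
    · intro a b hab ha
      have h := h3 (i.succAbove a) (i.succAbove b) (Fin.succAbove_lt_succAbove_iff.2 hab)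
        (by have := succAbove_val_cases i a; omega)
      simpa [shuffleExt_succAbove] using h
    · intro t ht
      have c1 := succAbove_val_cases i t
      have c2 := succAbove_val_cases j (τ t)
      rcases lt_or_ge t.val i.val with h | h
      · have h := h1 (i.succAbove t) i (by rw [Fin.lt_def]; omega) hi
        rw [shuffleExt_succAbove, shuffleExt_self, Fin.lt_def] at h
        omega
      · have h := h1 i (i.succAbove t) (by rw [Fin.lt_def]; omega) (by omega)
        rw [shuffleExt_succAbove, shuffleExt_self, Fin.lt_def] at h
        omega
  · rintro ⟨⟨h1, h2, h3⟩, h4⟩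
    refine ⟨?_, ?_, ?_⟩
    · intro a b hab hb
      rcases Fin.eq_self_or_eq_succAbove i a with rfl | ⟨s, rfl⟩
      · rcases Fin.eq_self_or_eq_succAbove a b with rfl | ⟨t, rfl⟩
        · exact absurd hab (lt_irrefl _)
        · have c1 := succAbove_val_cases a t
          have c2 := succAbove_val_cases j (τ t)
          rw [shuffleExt_succAbove, shuffleExt_self, Fin.lt_def]
          rw [Fin.lt_def] at hab
          have := h4 t (by omega)
          omega
      · rcases Fin.eq_self_or_eq_succAbove i b with rfl | ⟨t, rfl⟩
        · have c1 := succAbove_val_cases b s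
          have c2 := succAbove_val_cases j (τ s)
          rw [shuffleExt_succAbove, shuffleExt_self, Fin.lt_def]
          rw [Fin.lt_def] at hab
          have := h4 s (by omega)
          omega
        · have c1 := succAbove_val_cases i t
          rw [shuffleExt_succAbove, shuffleExt_succAbove, Fin.succAbove_lt_succAbove_iff]
          exact h1 _ _ (Fin.succAbove_lt_succAbove_iff.1 hab) (by omega)
    · intro a b hab ha hb
      rcases Fin.eq_self_or_eq_succAbove i a with rfl | ⟨s, rfl⟩
      · omega
      · rcases Fin.eq_self_or_eq_succAbove i b with rfl | ⟨t, rfl⟩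
        · rw [Fin.lt_def] at hab; omega
        · have c1 := succAbove_val_cases i t
          have c2 := succAbove_val_cases i s
          rw [shuffleExt_succAbove, shuffleExt_succAbove, Fin.succAbove_lt_succAbove_iff]
          rw [Fin.lt_def] at hab
          exact h2 _ _ (by rw [Fin.lt_def]; omega) (by omega) (by omega)
    · intro a b hab ha
      rcases Fin.eq_self_or_eq_succAbove i a with rfl | ⟨s, rfl⟩
      · omega
      · rcases Fin.eq_self_or_eq_succAbove i b with rfl | ⟨t, rfl⟩
        · rw [Fin.lt_def] at hab; omega
        · have c2 := succAbove_val_cases i s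
          rw [shuffleExt_succAbove, shuffleExt_succAbove, Fin.succAbove_lt_succAbove_iff]
          exact h3 _ _ (Fin.succAbove_lt_succAbove_iff.1 hab) (by omega)

theorem exists_unique_pos {n μ ν : ℕ} (hμ : 1 ≤ μ) (hn : μ ≤ n + 1) (j : Fin (n + 1))
    (τ : Equiv.Perm (Fin n)) (hτ : IsShuffle3 (μ - 1) ν τ) :
    ∃ i₀ : Fin (n + 1), ∀ i : Fin (n + 1),
      (i.val < μ ∧ IsShuffle3 μ ν (shuffleExt i j τ)) ↔ i = i₀ := by
  classical
  have hex : ∃ k : ℕ, μ - 1 ≤ k ∨ ∃ t : Fin n, t.val = k ∧ j.val ≤ (τ t).val :=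
    ⟨μ - 1, Or.inl le_rfl⟩
  have hle : Nat.find hex ≤ μ - 1 := Nat.find_min' hex (Or.inl le_rfl)
  have hspec := Nat.find_spec hex
  have hmin : ∀ t : Fin n, t.val < Nat.find hex → (τ t).val < j.val := by
    intro t ht
    have := Nat.find_min hex ht
    by_contra hc
    exact this (Or.inr ⟨t, rfl, by omega⟩)
  generalize Nat.find hex = k at hle hspec hmin
  have key : ∀ t : Fin n, t.val < μ - 1 → (t.val < k ↔ (τ t).val < j.val) := by
    intro t ht
    refine ⟨hmin t, fun h => ?_⟩
    by_contra hc
    rcases hspec with hs | ⟨s, hs, hs'⟩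
    · omega
    · rcases Nat.lt_or_ge s.val t.val with hl | hl
      · have := hτ.1 s t hl ht
        rw [Fin.lt_def] at this
        omega
      · have : s = t := Fin.ext (by omega)
        subst this
        omega
  clear hspec
  refine ⟨⟨k, by omega⟩, fun i => ⟨?_, ?_⟩⟩
  · rintro ⟨hi, hs⟩
    have h := ((shuffleExt_iff hμ i j hi τ).1 hs).2
    apply Fin.ext
    by_contra hne
    rcases Nat.lt_or_gt_of_ne hne with hl | hl
    · simp only at hl
      have e1 := h ⟨i.val, by omega⟩ (by simp only; omega)
      have e2 := key ⟨i.val, by omega⟩ (by simp only; omega)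
      simp only at e1 e2
      omega
    · simp only at hl
      have e1 := h ⟨k, by omega⟩ (by simp only; omega)
      have e2 := key ⟨k, by omega⟩ (by simp only; omega)
      simp only at e1 e2
      omega
  · rintro rfl
    have hk : k < μ := by omega
    exact ⟨hk, (shuffleExt_iff hμ _ j hk τ).2 ⟨hτ, key⟩⟩

open Classical in
/-- Summation identity over 3-shuffles, removal from the first block
(Lemma 4.1, identity (4.1), with `r = n + 1`): here positions are 0-based, so the
1-based sign `(−1)^{i−1}` becomes `(−1)^{i.val}`, the omitted tuple
`(σ(1),…,σ(i)̂,…,σ(r))` is `fun j => σ (i.succAbove j)`, and a 3-shuffle `τ` of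
`{1,…,r}∖{j}` is encoded as a 3-shuffle of `Fin n` whose value tuple is
`fun t => j.succAbove (τ t)`. -/
theorem shuffle3_sum_first_block {R : Type*} [CommRing R] (n μ ν : ℕ)
    (hμ : 1 ≤ μ) (hμν : μ + ν ≤ n + 1)
    (Φ : (Fin n → Fin (n + 1)) → R) (Ψ : Fin (n + 1) → R) :
    (∑ σ : Equiv.Perm (Fin (n + 1)),
      if IsShuffle3 μ ν σ then
        ∑ i : Fin (n + 1), if i.val < μ then
          (-1 : R) ^ i.val * ((Equiv.Perm.sign σ : ℤ) : R) *
            Φ (fun j => σ (i.succAbove j)) * Ψ (σ i)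
        else 0
      else 0)
    = ∑ j : Fin (n + 1), (-1 : R) ^ j.val * Ψ j *
        ∑ τ : Equiv.Perm (Fin n),
          if IsShuffle3 (μ - 1) ν τ then
            ((Equiv.Perm.sign τ : ℤ) : R) * Φ (fun t => j.succAbove (τ t))
          else 0 := by
  have hL : ∀ i : Fin (n + 1),
      (∑ σ : Equiv.Perm (Fin (n + 1)), if IsShuffle3 μ ν σ then
        (if i.val < μ then
          (-1 : R) ^ i.val * ((Equiv.Perm.sign σ : ℤ) : R) *
            Φ (fun j => σ (i.succAbove j)) * Ψ (σ i)
        else 0) else 0)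
      = ∑ j : Fin (n + 1), ∑ τ : Equiv.Perm (Fin n),
          if (i.val < μ ∧ IsShuffle3 μ ν (shuffleExt i j τ)) then
            (-1 : R) ^ j.val * Ψ j *
              (((Equiv.Perm.sign τ : ℤ) : R) * Φ (fun t => j.succAbove (τ t))) else 0 := by
    intro i
    rw [← Fintype.sum_prod_type', ← (shuffleExt_bijective i).sum_comp]
    refine Finset.sum_congr rfl fun p _ => ?_
    obtain ⟨j, τ⟩ := p
    simp only [shuffleExt_self, shuffleExt_succAbove, shuffleExt_sign]
    by_cases h1 : i.val < μ <;> by_cases h2 : IsShuffle3 μ ν (shuffleExt i j τ) <;>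
      simp only [h1, h2, if_true, if_false, and_true, and_false]
    have hs : (-1 : R) ^ i.val * (-1 : R) ^ i.val = 1 := by
      rw [← mul_pow]; simp
    push_cast
    linear_combination ((-1 : R) ^ j.val * ((Equiv.Perm.sign τ : ℤ) : R) *
      Φ (fun t => j.succAbove (τ t)) * Ψ j) * hs
  have hsw : ∀ σ : Equiv.Perm (Fin (n + 1)),
      (if IsShuffle3 μ ν σ then
        ∑ i : Fin (n + 1), if i.val < μ then
          (-1 : R) ^ i.val * ((Equiv.Perm.sign σ : ℤ) : R) *
            Φ (fun j => σ (i.succAbove j)) * Ψ (σ i)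
        else 0
      else 0) = ∑ i : Fin (n + 1), if IsShuffle3 μ ν σ then
        (if i.val < μ then
          (-1 : R) ^ i.val * ((Equiv.Perm.sign σ : ℤ) : R) *
            Φ (fun j => σ (i.succAbove j)) * Ψ (σ i)
        else 0) else 0 := by
    intro σ
    split_ifs
    · rfl
    · simp
  rw [Finset.sum_congr rfl fun σ _ => hsw σ, Finset.sum_comm,
    Finset.sum_congr rfl fun i _ => hL i, Finset.sum_comm]
  refine Finset.sum_congr rfl fun j _ => ?_
  rw [Finset.sum_comm, Finset.mul_sum]
  refine Finset.sum_congr rfl fun τ _ => ?_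
  by_cases hτ : IsShuffle3 (μ - 1) ν τ
  · obtain ⟨i₀, h⟩ := exists_unique_pos hμ (by omega) j τ hτ
    simp only [h, hτ, if_true, Finset.sum_ite_eq', Finset.sum_ite_eq, Finset.mem_univ]
  · rw [if_neg hτ, mul_zero]
    refine Finset.sum_eq_zero fun i _ => if_neg ?_
    rintro ⟨hi, hs⟩
    exact hτ ((shuffleExt_iff hμ i j hi τ).1 hs).1
end

section
/- Suppose r − μ − ν ≥ 1. Then ∑_{σ ∈ J_{μ,ν}(1,…,r)} ∑_{i=1}^{r−μ−ν} (−1)^{μ+ν+i−1}·(−1)^{σ}·Φ(σ(1), …, σ(μ+ν+i)̂, …, σ(r))·Ψ(σ(μ+ν+i)) = ∑_{j=1}^{r} (−1)^{j−1}·Ψ(j)·∑_{τ ∈ J_{μ,ν}(1,…,ĵ,…,r)} (−1)^{τ}·Φ(τ(1), …, τ(r−1)), where σ(μ+ν+i)̂ means the (μ+ν+i)-th entry is omitted from the tuple (σ(1),…,σ(r)). -/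
open Finset

/-- The permutation of `Fin (n+1)` sending `i` to `j` and acting as `τ` elsewhere. -/
def insPerm {n : ℕ} (i j : Fin (n + 1)) (τ : Equiv.Perm (Fin n)) : Equiv.Perm (Fin (n + 1)) :=
  (Fin.cycleRange j)⁻¹ * Equiv.Perm.decomposeFin.symm (0, τ) * Fin.cycleRange i

theorem insPerm_self {n : ℕ} (i j : Fin (n + 1)) (τ : Equiv.Perm (Fin n)) :
    insPerm i j τ i = j := by
  simp [insPerm, Equiv.Perm.inv_def]

theorem insPerm_succAbove {n : ℕ} (i j : Fin (n + 1)) (τ : Equiv.Perm (Fin n)) (t : Fin n) :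
    insPerm i j τ (i.succAbove t) = j.succAbove (τ t) := by
  simp [insPerm, Equiv.Perm.inv_def]

theorem sign_insPerm {n : ℕ} (i j : Fin (n + 1)) (τ : Equiv.Perm (Fin n)) :
    Equiv.Perm.sign (insPerm i j τ)
      = (-1) ^ j.val * Equiv.Perm.sign τ * (-1) ^ i.val := by
  simp [insPerm, Equiv.Perm.decomposeFin.symm_sign]

theorem insPerm_bijective {n : ℕ} (i : Fin (n + 1)) :
    Function.Bijective (fun p : Fin (n + 1) × Equiv.Perm (Fin n) => insPerm i p.1 p.2) := by
  rw [Fintype.bijective_iff_injective_and_card]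
  constructor
  · rintro ⟨j, τ⟩ ⟨j', τ'⟩ h
    simp only at h
    have h1 : j = j' := by
      rw [← insPerm_self i j τ, h, insPerm_self]
    subst h1
    have h2 : τ = τ' := by
      ext t : 1
      apply Fin.succAbove_right_injective (p := j)
      rw [← insPerm_succAbove i j τ, h, insPerm_succAbove]
    rw [h2]
  · simp [Fintype.card_perm, Nat.factorial_succ]

theorem isShuffle3_insPerm {n μ ν : ℕ} (i j : Fin (n + 1)) (τ : Equiv.Perm (Fin n))
    (hi : μ + ν ≤ i.val) :
    IsShuffle3 μ ν (insPerm i j τ) ↔ IsShuffle3 μ ν τ ∧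
      ∀ t : Fin n, μ + ν ≤ t.val → (t.val < i.val ↔ (τ t).castSucc < j) := by
  have hlo : ∀ t : Fin n, t.val < i.val → (i.succAbove t).val = t.val := by
    intro t ht
    rw [Fin.succAbove_of_castSucc_lt _ _ (by simpa [Fin.lt_def] using ht)]; simp
  have hhi : ∀ t : Fin n, i.val ≤ t.val → (i.succAbove t).val = t.val + 1 := by
    intro t ht
    rw [Fin.succAbove_of_le_castSucc _ _ (by simpa [Fin.le_def] using ht)]; simp
  constructor
  · rintro ⟨h1, h2, h3⟩
    refine ⟨⟨?_, ?_, ?_⟩, ?_⟩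
    · intro a b hab hb
      have := h1 (i.succAbove a) (i.succAbove b) (by simpa using hab)
        (by rw [hlo b (by omega)]; exact hb)
      simpa [insPerm_succAbove] using this
    · intro a b hab ha hb
      have hab' : a.val < b.val := hab
      have := h2 (i.succAbove a) (i.succAbove b) (by simpa using hab)
        (by rw [hlo a (by omega)]; exact ha)
        (by rw [hlo b (by omega)]; exact hb)
      simpa [insPerm_succAbove] using this
    · intro a b hab ha
      have := h3 (i.succAbove a) (i.succAbove b) (by simpa using hab)
        (by rcases lt_or_ge a.val i.val with h | h
            · rw [hlo a h]; exact ha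
            · rw [hhi a h]; omega)
      simpa [insPerm_succAbove] using this
    · intro t ht
      constructor
      · intro hti
        have := h3 (i.succAbove t) i (by rw [Fin.lt_def, hlo t hti]; exact hti)
          (by rw [hlo t hti]; exact ht)
        rw [insPerm_self, insPerm_succAbove] at this
        exact Fin.succAbove_lt_iff_castSucc_lt _ _ |>.1 this
      · intro hlt
        by_contra hti
        push Not at hti
        have := h3 i (i.succAbove t) (by rw [Fin.lt_def, hhi t hti]; omega) hi
        rw [insPerm_self, insPerm_succAbove] at this
        have h4 := Fin.succAbove_lt_iff_castSucc_lt _ _ |>.2 hlt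
        exact absurd this (not_lt.2 h4.le)
  · rintro ⟨⟨h1, h2, h3⟩, h4⟩
    refine ⟨?_, ?_, ?_⟩
    · intro a b hab hb
      have hab' : a.val < b.val := hab
      rcases Fin.eq_self_or_eq_succAbove i a with rfl | ⟨a, rfl⟩
      · omega
      rcases Fin.eq_self_or_eq_succAbove i b with rfl | ⟨b, rfl⟩
      · omega
      rw [insPerm_succAbove, insPerm_succAbove, Fin.succAbove_lt_succAbove_iff]
      apply h1 a b (by simpa using hab)
      rcases lt_or_ge b.val i.val with h | h
      · rwa [hlo b h] at hb
      · rw [hhi b h] at hb; omega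
    · intro a b hab ha hb
      have hab' : a.val < b.val := hab
      rcases Fin.eq_self_or_eq_succAbove i a with rfl | ⟨a, rfl⟩
      · omega
      rcases Fin.eq_self_or_eq_succAbove i b with rfl | ⟨b, rfl⟩
      · omega
      rw [insPerm_succAbove, insPerm_succAbove, Fin.succAbove_lt_succAbove_iff]
      have := hlo a
      have := hhi a
      have := hlo b
      have := hhi b
      apply h2 a b (by simpa using hab) <;> omega
    · intro a b hab ha
      have hab' : a.val < b.val := hab
      rcases Fin.eq_self_or_eq_succAbove i a with rfl | ⟨a, rfl⟩
      · rcases Fin.eq_self_or_eq_succAbove a b with rfl | ⟨b, rfl⟩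
        · omega
        have := hlo b
        have := hhi b
        have h5 := h4 b (by omega)
        rw [insPerm_succAbove, insPerm_self, Fin.lt_succAbove_iff_le_castSucc]
        rw [← not_lt, ← h5]
        omega
      have := hlo a
      have := hhi a
      rcases Fin.eq_self_or_eq_succAbove i b with rfl | ⟨b, rfl⟩
      · rw [insPerm_succAbove, insPerm_self, Fin.succAbove_lt_iff_castSucc_lt]
        rw [← h4 a (by omega)]
        omega
      rw [insPerm_succAbove, insPerm_succAbove, Fin.succAbove_lt_succAbove_iff]
      apply h3 a b (by simpa using hab)
      omega

theorem exists_unique_slot {n μ ν : ℕ} (hμν : μ + ν ≤ n) (j : Fin (n + 1))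
    (τ : Equiv.Perm (Fin n)) (hτ : IsShuffle3 μ ν τ) :
    ∃! i : Fin (n + 1), μ + ν ≤ i.val ∧ IsShuffle3 μ ν (insPerm i j τ) := by
  classical
  have hex : ∃ k : ℕ, μ + ν ≤ k ∧ ∀ t : Fin n, k ≤ t.val → j ≤ (τ t).castSucc :=
    ⟨n, hμν, fun t ht => absurd t.isLt (by omega)⟩
  obtain ⟨hk1, hk2⟩ := Nat.find_spec hex
  have hkn : Nat.find hex ≤ n :=
    Nat.find_min' hex ⟨hμν, fun t ht => absurd t.isLt (by omega)⟩
  have hmin := fun m => @Nat.find_min _ _ hex m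
  generalize Nat.find hex = k at *
  refine ⟨⟨k, by omega⟩, ⟨hk1, ?_⟩, ?_⟩
  · rw [isShuffle3_insPerm _ _ _ hk1]
    refine ⟨hτ, fun t ht => ⟨fun htk => ?_, fun hlt => ?_⟩⟩
    · by_contra hge
      push Not at hge
      refine hmin t.val htk ⟨ht, fun s hs => ?_⟩
      rcases eq_or_lt_of_le hs with h | h
      · rwa [← Fin.ext h]
      · have := hτ.2.2 t s h ht
        exact hge.trans (Fin.castSucc_le_castSucc_iff.2 this.le)
    · by_contra hge
      exact absurd hlt (not_lt.2 (hk2 t (not_lt.1 hge)))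
  · rintro i' ⟨hi1, hi2⟩
    rw [isShuffle3_insPerm _ _ _ hi1] at hi2
    have hi3 := i'.isLt
    rcases lt_trichotomy i'.val k with h | h | h
    · exfalso
      refine hmin _ h ⟨hi1, fun t ht => ?_⟩
      rw [← not_lt, ← hi2.2 t (by omega)]
      omega
    · exact Fin.ext h
    · exfalso
      have h5 := (hi2.2 ⟨k, by omega⟩ hk1).1 h
      exact absurd h5 (not_lt.2 (hk2 ⟨k, by omega⟩ le_rfl))

open Classical in
/-- Summation identity over 3-shuffles, removal from the third block
(Lemma 4.1, identity (4.3), with `r = n + 1`; the hypothesis `μ + ν ≤ n` says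
`r − μ − ν ≥ 1`): positions are 0-based, so the 1-based position `μ + ν + i`
with sign `(−1)^{μ+ν+i−1}` becomes a position `i` with `μ + ν ≤ i.val` and sign
`(−1)^{i.val}`. -/
theorem shuffle3_sum_third_block {R : Type*} [CommRing R] (n μ ν : ℕ)
    (hμν : μ + ν ≤ n)
    (Φ : (Fin n → Fin (n + 1)) → R) (Ψ : Fin (n + 1) → R) :
    (∑ σ : Equiv.Perm (Fin (n + 1)),
      if IsShuffle3 μ ν σ then
        ∑ i : Fin (n + 1), if μ + ν ≤ i.val then
          (-1 : R) ^ i.val * ((Equiv.Perm.sign σ : ℤ) : R) *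
            Φ (fun j => σ (i.succAbove j)) * Ψ (σ i)
        else 0
      else 0)
    = ∑ j : Fin (n + 1), (-1 : R) ^ j.val * Ψ j *
        ∑ τ : Equiv.Perm (Fin n),
          if IsShuffle3 μ ν τ then
            ((Equiv.Perm.sign τ : ℤ) : R) * Φ (fun t => j.succAbove (τ t))
          else 0 := by
  have key : ∀ (j : Fin (n + 1)) (τ : Equiv.Perm (Fin n)),
      (∑ i : Fin (n + 1), if μ + ν ≤ i.val ∧ IsShuffle3 μ ν (insPerm i j τ) then (1 : R) else 0)
        = if IsShuffle3 μ ν τ then 1 else 0 := by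
    intro j τ
    split_ifs with hτ
    · obtain ⟨i, hi, huniq⟩ := exists_unique_slot hμν j τ hτ
      rw [Finset.sum_eq_single i]
      · rw [if_pos hi]
      · intro b _ hb
        rw [if_neg (fun h => hb (huniq b h))]
      · simp
    · apply Finset.sum_eq_zero
      intro i _
      rw [if_neg]
      rintro ⟨h1, h2⟩
      exact hτ ((isShuffle3_insPerm _ _ _ h1).1 h2).1
  have hL : ∀ σ : Equiv.Perm (Fin (n + 1)),
      (if IsShuffle3 μ ν σ then
        ∑ i : Fin (n + 1), if μ + ν ≤ i.val then
          (-1 : R) ^ i.val * ((Equiv.Perm.sign σ : ℤ) : R) *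
            Φ (fun j => σ (i.succAbove j)) * Ψ (σ i)
        else 0
      else 0) = ∑ i : Fin (n + 1), if μ + ν ≤ i.val ∧ IsShuffle3 μ ν σ then
          (-1 : R) ^ i.val * ((Equiv.Perm.sign σ : ℤ) : R) *
            Φ (fun j => σ (i.succAbove j)) * Ψ (σ i) else 0 := by
    intro σ
    split_ifs with h <;> simp [h]
  rw [Finset.sum_congr rfl (fun σ _ => hL σ), Finset.sum_comm]
  have hI : ∀ i : Fin (n + 1),
      (∑ σ : Equiv.Perm (Fin (n + 1)), if μ + ν ≤ i.val ∧ IsShuffle3 μ ν σ then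
          (-1 : R) ^ i.val * ((Equiv.Perm.sign σ : ℤ) : R) *
            Φ (fun j => σ (i.succAbove j)) * Ψ (σ i) else 0)
      = ∑ p : Fin (n + 1) × Equiv.Perm (Fin n),
          ((-1 : R) ^ p.1.val * Ψ p.1 * (((Equiv.Perm.sign p.2 : ℤ) : R) *
            Φ (fun t => p.1.succAbove (p.2 t)))) *
          (if μ + ν ≤ i.val ∧ IsShuffle3 μ ν (insPerm i p.1 p.2) then (1 : R) else 0) := by
    intro i
    rw [← (insPerm_bijective i).sum_comp]
    refine Finset.sum_congr rfl fun p _ => ?_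
    split_ifs with h
    · simp only [insPerm_self, insPerm_succAbove, sign_insPerm]
      have h1 : (-1 : R) ^ i.val * (-1 : R) ^ i.val = 1 := by
        rw [← mul_pow]; simp
      push_cast
      linear_combination ((-1 : R) ^ p.1.val * Ψ p.1 * (((Equiv.Perm.sign p.2 : ℤ) : R) *
            Φ (fun t => p.1.succAbove (p.2 t)))) * h1
    · simp
  rw [Finset.sum_congr rfl (fun i _ => hI i), Finset.sum_comm, Fintype.sum_prod_type]
  refine Finset.sum_congr rfl fun j _ => ?_
  rw [Finset.mul_sum]
  refine Finset.sum_congr rfl fun τ _ => ?_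
  rw [← Finset.mul_sum, key]
  split_ifs <;> simp
end

section
/- Suppose μ ≥ 1. Then ∑_{σ ∈ J_{μ}(1,…,r)} ∑_{i=1}^{μ} (−1)^{i−1}·(−1)^{σ}·Φ(σ(1), …, σ(i)̂, …, σ(r))·Ψ(σ(i)) = ∑_{j=1}^{r} (−1)^{j−1}·Ψ(j)·∑_{τ ∈ J_{μ−1}(1,…,ĵ,…,r)} (−1)^{τ}·Φ(τ(1), …, τ(r−1)), where σ(i)̂ means the i-th entry is omitted from the tuple (σ(1),…,σ(r)). -/
open Finset

/-- `σ` is a 2-shuffle with block sizes `μ` and `r − μ`: it is strictly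
increasing on the first `μ` positions and on the remaining positions. -/
def IsShuffle2 {r : ℕ} (μ : ℕ) (σ : Equiv.Perm (Fin r)) : Prop :=
  (∀ i j : Fin r, i < j → j.val < μ → σ i < σ j) ∧
  (∀ i j : Fin r, i < j → μ ≤ i.val → σ i < σ j)

/-- Insert the value `j` at position `i` into the permutation `τ`. -/
def shExt {n : ℕ} (i j : Fin (n + 1)) (τ : Equiv.Perm (Fin n)) : Equiv.Perm (Fin (n + 1)) :=
  (Fin.cycleRange j)⁻¹ * Equiv.Perm.decomposeFin.symm (0, τ) * Fin.cycleRange i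

lemma shExt_self {n : ℕ} (i j : Fin (n + 1)) (τ : Equiv.Perm (Fin n)) :
    shExt i j τ i = j := by
  simp [shExt, Equiv.Perm.inv_def]

lemma shExt_succAbove {n : ℕ} (i j : Fin (n + 1)) (τ : Equiv.Perm (Fin n)) (t : Fin n) :
    shExt i j τ (i.succAbove t) = j.succAbove (τ t) := by
  simp [shExt, Equiv.Perm.inv_def]

lemma shExt_sign {n : ℕ} (i j : Fin (n + 1)) (τ : Equiv.Perm (Fin n)) :
    Equiv.Perm.sign (shExt i j τ) = (-1) ^ j.val * Equiv.Perm.sign τ * (-1) ^ i.val := by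
  simp [shExt, Equiv.Perm.decomposeFin.symm_sign, Fin.sign_cycleRange]

lemma shExt_bij {n : ℕ} (i : Fin (n + 1)) :
    Function.Bijective (fun p : Fin (n + 1) × Equiv.Perm (Fin n) => shExt i p.1 p.2) := by
  rw [Fintype.bijective_iff_injective_and_card]
  constructor
  · rintro ⟨j, τ⟩ ⟨k, ρ⟩ h
    simp only at h
    have hj : j = k := by rw [← shExt_self i j τ, h, shExt_self]
    subst hj
    have : τ = ρ := by
      ext1 t
      have := shExt_succAbove i j τ t
      rw [h, shExt_succAbove] at this
      exact (Fin.succAbove_right_injective this).symm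
    rw [this]
  · simp [Fintype.card_perm, Nat.factorial_succ]

/-- The position condition. -/
def shPos {n : ℕ} (μ : ℕ) (j : Fin (n + 1)) (τ : Equiv.Perm (Fin n)) (i : Fin (n + 1)) : Prop :=
  i.val < μ ∧ ∀ t : Fin n, t.val < μ - 1 → (t.castSucc < i ↔ (τ t).castSucc < j)

lemma shExt_iff {n : ℕ} (μ : ℕ) (i j : Fin (n + 1)) (τ : Equiv.Perm (Fin n)) :
    (IsShuffle2 μ (shExt i j τ) ∧ i.val < μ) ↔ (IsShuffle2 (μ - 1) τ ∧ shPos μ j τ i) := by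
  have hval : ∀ t : Fin n, (i.succAbove t).val = if t.val < i.val then t.val else t.val + 1 := by
    intro t
    simp only [Fin.succAbove, Fin.lt_def, Fin.val_castSucc]
    split_ifs <;> simp
  constructor
  · rintro ⟨⟨h1, h2⟩, hi⟩
    refine ⟨⟨?_, ?_⟩, hi, ?_⟩
    · intro a b hab hb
      have := h1 (i.succAbove a) (i.succAbove b) (by simpa using hab)
        (by rw [hval]; split_ifs <;> omega)
      simpa [shExt_succAbove] using this
    · intro a b hab ha
      have := h2 (i.succAbove a) (i.succAbove b) (by simpa using hab)
        (by rw [hval]; split_ifs <;> omega)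
      simpa [shExt_succAbove] using this
    · intro t ht
      have hlt : (i.succAbove t).val < μ := by rw [hval]; split_ifs <;> omega
      constructor
      · intro h
        have := h1 (i.succAbove t) i (by simpa [Fin.succAbove_lt_iff_castSucc_lt] using h) hi
        rw [shExt_succAbove, shExt_self, Fin.succAbove_lt_iff_castSucc_lt] at this
        exact this
      · intro h
        by_contra hc
        have := h1 i (i.succAbove t)
          (by rw [Fin.lt_succAbove_iff_le_castSucc]; exact not_lt.mp hc) hlt
        rw [shExt_succAbove, shExt_self, Fin.lt_succAbove_iff_le_castSucc] at this
        exact absurd h (not_lt.mpr this)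
  · rintro ⟨⟨h1, h2⟩, hi, hp⟩
    refine ⟨⟨?_, ?_⟩, hi⟩
    · intro a b hab hb
      rcases Fin.eq_self_or_eq_succAbove i a with rfl | ⟨s, rfl⟩
      · rcases Fin.eq_self_or_eq_succAbove a b with rfl | ⟨t, rfl⟩
        · exact absurd hab (lt_irrefl _)
        · rw [shExt_succAbove, shExt_self, Fin.lt_succAbove_iff_le_castSucc]
          rw [Fin.lt_succAbove_iff_le_castSucc] at hab
          have h3 : a.val ≤ t.val := by simpa [Fin.le_def] using hab
          rw [hval, if_neg (by omega)] at hb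
          exact not_lt.mp fun h => absurd ((hp t (by omega)).2 h) (not_lt.mpr hab)
      · rcases Fin.eq_self_or_eq_succAbove i b with rfl | ⟨t, rfl⟩
        · rw [shExt_succAbove, shExt_self, Fin.succAbove_lt_iff_castSucc_lt]
          rw [Fin.succAbove_lt_iff_castSucc_lt] at hab
          have h3 : s.val < b.val := by simpa [Fin.lt_def] using hab
          exact (hp s (by omega)).1 hab
        · rw [shExt_succAbove, shExt_succAbove, Fin.succAbove_lt_succAbove_iff]
          rw [Fin.succAbove_lt_succAbove_iff] at hab
          refine h1 s t hab ?_
          rw [hval] at hb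
          split_ifs at hb <;> omega
    · intro a b hab ha
      rcases Fin.eq_self_or_eq_succAbove i a with rfl | ⟨s, rfl⟩
      · omega
      · rcases Fin.eq_self_or_eq_succAbove i b with rfl | ⟨t, rfl⟩
        · have := Fin.lt_def.mp hab
          omega
        · rw [shExt_succAbove, shExt_succAbove, Fin.succAbove_lt_succAbove_iff]
          rw [Fin.succAbove_lt_succAbove_iff] at hab
          refine h2 s t hab ?_
          rw [hval] at ha
          split_ifs at ha <;> omega

lemma shPos_existsUnique {n : ℕ} (μ : ℕ) (hμ : 1 ≤ μ) (hμr : μ ≤ n + 1) (j : Fin (n + 1))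
    (τ : Equiv.Perm (Fin n)) (hτ : IsShuffle2 (μ - 1) τ) : ∃! i, shPos μ j τ i := by
  classical
  have hex : ∃ k : ℕ, μ - 1 ≤ k ∨ ∃ h : k < n, j ≤ (τ ⟨k, h⟩).castSucc := ⟨μ - 1, Or.inl le_rfl⟩
  have hle : Nat.find hex ≤ μ - 1 := Nat.find_min' hex (Or.inl le_rfl)
  refine existsUnique_of_exists_of_unique ⟨⟨Nat.find hex, by omega⟩, ⟨by simp only; omega, ?_⟩⟩ ?_
  · intro t ht
    rw [Fin.lt_def]
    simp only [Fin.val_castSucc]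
    constructor
    · intro h
      have := Nat.find_min hex h
      push Not at this
      exact this.2 t.isLt
    · intro h
      by_contra hc
      rcases Nat.find_spec hex with h0 | ⟨hk, h0⟩
      · omega
      · rcases Nat.lt_or_ge (Nat.find hex) t.val with h3 | h3
        · have := hτ.1 ⟨Nat.find hex, hk⟩ t h3 ht
          rw [Fin.lt_def] at this h
          rw [Fin.le_def] at h0
          simp only [Fin.val_castSucc] at h h0
          omega
        · have : (⟨Nat.find hex, hk⟩ : Fin n) = t := Fin.ext (by simp only; omega)
          rw [this] at h0
          exact absurd h (not_lt.mpr h0)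
  · have key : ∀ x y : Fin (n + 1), shPos μ j τ x → shPos μ j τ y → ¬ x < y := by
      intro x y hx hy hxy
      rw [Fin.lt_def] at hxy
      have hy1 := hy.1
      have hxn : x.val < n := by omega
      have a := hx.2 ⟨x.val, hxn⟩ (by simp only; omega)
      have b := hy.2 ⟨x.val, hxn⟩ (by simp only; omega)
      rw [← b] at a
      simp only [Fin.lt_def, Fin.val_castSucc] at a
      omega
    intro x y hx hy
    exact le_antisymm (not_lt.mp (key _ _ hy hx)) (not_lt.mp (key _ _ hx hy))

open Classical in
/-- Summation identity over 2-shuffles, removal from the first block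
(Remark 4.2, identity (4.4), with `r = n + 1`): positions are 0-based, so the
1-based sign `(−1)^{i−1}` becomes `(−1)^{i.val}`; the omitted tuple
`(σ(1),…,σ(i)̂,…,σ(r))` is `fun j => σ (i.succAbove j)`, and a 2-shuffle `τ` of
`{1,…,r}∖{j}` is encoded as a 2-shuffle of `Fin n` whose value tuple is
`fun t => j.succAbove (τ t)`. -/
theorem shuffle2_sum_first_block {R : Type*} [CommRing R] (n μ : ℕ)
    (hμ : 1 ≤ μ) (hμr : μ ≤ n + 1)
    (Φ : (Fin n → Fin (n + 1)) → R) (Ψ : Fin (n + 1) → R) :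
    (∑ σ : Equiv.Perm (Fin (n + 1)),
      if IsShuffle2 μ σ then
        ∑ i : Fin (n + 1), if i.val < μ then
          (-1 : R) ^ i.val * ((Equiv.Perm.sign σ : ℤ) : R) *
            Φ (fun j => σ (i.succAbove j)) * Ψ (σ i)
        else 0
      else 0)
    = ∑ j : Fin (n + 1), (-1 : R) ^ j.val * Ψ j *
        ∑ τ : Equiv.Perm (Fin n),
          if IsShuffle2 (μ - 1) τ then
            ((Equiv.Perm.sign τ : ℤ) : R) * Φ (fun t => j.succAbove (τ t))
          else 0 := by
  have step : ∀ i : Fin (n + 1),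
      (∑ σ : Equiv.Perm (Fin (n + 1)), if IsShuffle2 μ σ then
        (if i.val < μ then (-1 : R) ^ i.val * ((Equiv.Perm.sign σ : ℤ) : R) *
            Φ (fun j => σ (i.succAbove j)) * Ψ (σ i) else 0) else 0)
      = ∑ j : Fin (n + 1), ∑ τ : Equiv.Perm (Fin n),
          if IsShuffle2 (μ - 1) τ ∧ shPos μ j τ i then
            (-1 : R) ^ j.val * Ψ j *
              (((Equiv.Perm.sign τ : ℤ) : R) * Φ (fun t => j.succAbove (τ t))) else 0 := by
    intro i
    rw [← (shExt_bij i).sum_comp, Fintype.sum_prod_type]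
    refine Finset.sum_congr rfl fun j _ => Finset.sum_congr rfl fun τ _ => ?_
    simp only
    rw [← ite_and]
    refine if_congr (shExt_iff μ i j τ) ?_ rfl
    simp only [shExt_succAbove, shExt_self, shExt_sign]
    push_cast
    have h : (-1 : R) ^ i.val * (-1 : R) ^ i.val = 1 := by
      rw [← mul_pow]; simp
    linear_combination ((-1 : R) ^ j.val * ((Equiv.Perm.sign τ : ℤ) : R) *
      Φ (fun t => j.succAbove (τ t)) * Ψ j) * h
  have comm : ∀ σ : Equiv.Perm (Fin (n + 1)), (if IsShuffle2 μ σ then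
        ∑ i : Fin (n + 1), if i.val < μ then
          (-1 : R) ^ i.val * ((Equiv.Perm.sign σ : ℤ) : R) *
            Φ (fun j => σ (i.succAbove j)) * Ψ (σ i)
        else 0
      else 0) = ∑ i : Fin (n + 1), if IsShuffle2 μ σ then
        (if i.val < μ then (-1 : R) ^ i.val * ((Equiv.Perm.sign σ : ℤ) : R) *
            Φ (fun j => σ (i.succAbove j)) * Ψ (σ i) else 0) else 0 := by
    intro σ
    split_ifs <;> simp
  rw [Finset.sum_congr rfl fun σ _ => comm σ, Finset.sum_comm,
    Finset.sum_congr rfl fun i _ => step i, Finset.sum_comm]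
  refine Finset.sum_congr rfl fun j _ => ?_
  rw [Finset.sum_comm, Finset.mul_sum]
  refine Finset.sum_congr rfl fun τ _ => ?_
  by_cases hτ : IsShuffle2 (μ - 1) τ
  · obtain ⟨i, hi, hu⟩ := shPos_existsUnique μ hμ hμr j τ hτ
    rw [Finset.sum_eq_single i]
    · rw [if_pos ⟨hτ, hi⟩, if_pos hτ]
    · intro k _ hk
      exact if_neg fun h => hk (hu k h.2)
    · intro h
      exact absurd (Finset.mem_univ i) h
  · simp [hτ]
end

section
/- Let σ ∈ J_{μ,ν}(1,…,r) with μ ≥ 1, let 1 ≤ i ≤ μ, and set j = σ(i). Let τ be the bijection of {1,…,r}∖{j} (equivalently, via the order isomorphism, a permutation of {1,…,r−1}) whose three increasing blocks of sizes μ−1, ν, r−μ−ν are (σ(1),…,σ(i)̂,…,σ(μ)), (σ(μ+1),…,σ(μ+ν)), and (σ(μ+ν+1),…,σ(r)). Then τ ∈ J_{μ−1,ν}(1,…,ĵ,…,r) and the signs satisfy (−1)^{σ}·(−1)^{i−1} = (−1)^{τ}·(−1)^{j−1}. -/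
/-- Let `σ ∈ J_{μ,ν}(1,…,r)` with `μ ≥ 1` (here `r = n + 1` and positions are
0-based, so a 1-based position `i ≤ μ` becomes `p` with `p.val < μ`, and
`j = σ(p)`). The bijection `τ` of `{1,…,r}∖{j}` obtained by deleting the entry
`j` from the first block of `σ` — i.e. (via the order isomorphism
`{1,…,r}∖{j} ≅ {1,…,r−1}`) the permutation `τ` of `Fin n` whose value tuple
satisfies `(σ p).succAbove (τ t) = σ (p.succAbove t)` — exists, lies in
`J_{μ−1,ν}(1,…,ĵ,…,r)`, and satisfies the sign relation
`(−1)^σ·(−1)^{i−1} = (−1)^τ·(−1)^{j−1}`, which in 0-based indexing reads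
`sign σ · (−1)^{p.val} = sign τ · (−1)^{(σ p).val}`. -/
theorem shuffle3_delete_first_block (n μ ν : ℕ) (hμ : 1 ≤ μ) (hμν : μ + ν ≤ n + 1)
    (σ : Equiv.Perm (Fin (n + 1))) (hσ : IsShuffle3 μ ν σ)
    (p : Fin (n + 1)) (hp : p.val < μ) :
    ∃ τ : Equiv.Perm (Fin n),
      (∀ t : Fin n, (σ p).succAbove (τ t) = σ (p.succAbove t)) ∧
      IsShuffle3 (μ - 1) ν τ ∧
      (Equiv.Perm.sign σ : ℤ) * (-1) ^ p.val
        = (Equiv.Perm.sign τ : ℤ) * (-1) ^ (σ p).val := by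
  obtain ⟨⟨q, τ⟩, hρ⟩ := Equiv.Perm.decomposeFin.symm.surjective
    ((σ p).cycleRange * σ * p.cycleRange⁻¹)
  have hq : q = 0 := by
    have h := congrArg (fun e : Equiv.Perm (Fin (n + 1)) => e 0) hρ
    simpa [Equiv.Perm.mul_apply, Equiv.Perm.inv_def] using h
  subst hq
  have key : ∀ t : Fin n, (σ p).succAbove (τ t) = σ (p.succAbove t) := by
    intro t
    have h := congrArg (fun e : Equiv.Perm (Fin (n + 1)) => e t.succ) hρ
    simp only [Equiv.Perm.decomposeFin_symm_apply_succ, Equiv.Perm.mul_apply, Equiv.Perm.inv_def,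
      Fin.cycleRange_symm_succ, Equiv.swap_self, Equiv.refl_apply] at h
    rw [← Fin.cycleRange_symm_succ, h, Equiv.symm_apply_apply]
  have hlt : ∀ a b : Fin n, σ (p.succAbove a) < σ (p.succAbove b) → τ a < τ b := by
    intro a b h
    rw [← key, ← key] at h
    exact (Fin.succAbove_lt_succAbove_iff).1 h
  have hv : ∀ a : Fin n, (p.succAbove a).val = if a.val < p.val then a.val else a.val + 1 := by
    intro a
    simp only [Fin.succAbove, Fin.lt_def, Fin.val_castSucc]
    split_ifs <;> simp
  obtain ⟨h1, h2, h3⟩ := hσ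
  refine ⟨τ, key, ⟨?_, ?_, ?_⟩, ?_⟩
  · intro a b hab hb
    refine hlt _ _ (h1 _ _ (Fin.succAbove_lt_succAbove_iff.2 hab) ?_)
    rw [hv]; split_ifs <;> omega
  · intro a b hab ha hb
    refine hlt _ _ (h2 _ _ (Fin.succAbove_lt_succAbove_iff.2 hab) ?_ ?_) <;>
    · rw [hv]; split_ifs <;> omega
  · intro a b hab ha
    refine hlt _ _ (h3 _ _ (Fin.succAbove_lt_succAbove_iff.2 hab) ?_)
    rw [hv]; split_ifs <;> omega
  · have h := congrArg Equiv.Perm.sign hρ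
    simp only [Equiv.Perm.decomposeFin.symm_sign, if_true, one_mul, Equiv.Perm.sign_mul,
      Equiv.Perm.sign_inv, Fin.sign_cycleRange] at h
    rw [h]
    push_cast
    have h4 : ((-1 : ℤ) ^ (σ p).val) * (-1) ^ (σ p).val = 1 := by
      rw [← mul_pow]; simp
    linear_combination (-(Equiv.Perm.sign σ : ℤ) * (-1) ^ p.val) * h4
end

section
/- For all r, t, k ∈ ℕ: ∑_{m=0}^{k} binom(m+r, r)·binom(k−m+t, t)·C_{m+r, k−m+t} = binom(−r−t−1, k)·C_{r,t}, where binom(−r−t−1, k) denotes the generalized binomial coefficient (−r−t−1)(−r−t−2)⋯(−r−t−k)/k! = (−1)^k·binom(r+t+k, k). -/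
open Finset

/-- The generalized binomial coefficient `binom(x, k) = x(x-1)⋯(x-k+1)/k!` for `x : ℚ`. -/
noncomputable def genBinom (x : ℚ) (k : ℕ) : ℚ :=
  (∏ i ∈ Finset.range k, (x - i)) / (Nat.factorial k)

/-- The constants `C_{m,n} = (1/2)·((m−n)/(m+n+1))·binom(−1/2,m)·binom(−1/2,n)`. -/
noncomputable def Cmn (m n : ℕ) : ℚ :=
  (1 / 2) * (((m : ℚ) - n) / ((m : ℚ) + n + 1)) *
    genBinom (-(1 / 2)) m * genBinom (-(1 / 2)) n

lemma gb_zero (x : ℚ) : genBinom x 0 = 1 := by simp [genBinom]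

lemma gb_succ (x : ℚ) (k : ℕ) :
    ((k : ℚ) + 1) * genBinom x (k + 1) = (x - k) * genBinom x k := by
  have h1 : ((k : ℚ) + 1) ≠ 0 := by positivity
  have h2 : (Nat.factorial k : ℚ) ≠ 0 := by positivity
  unfold genBinom
  rw [Finset.prod_range_succ, Nat.factorial_succ]
  push_cast
  field_simp

lemma gb_succ_left (x : ℚ) (k : ℕ) :
    ((k : ℚ) + 1) * genBinom x (k + 1) = x * genBinom (x - 1) k := by
  have h1 : ((k : ℚ) + 1) ≠ 0 := by positivity
  have h2 : (Nat.factorial k : ℚ) ≠ 0 := by positivity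
  have h3 : ∏ i ∈ Finset.range k, (x - ((i + 1 : ℕ) : ℚ))
      = ∏ i ∈ Finset.range k, (x - 1 - (i : ℚ)) := by
    apply Finset.prod_congr rfl
    intro i _
    push_cast
    ring
  unfold genBinom
  rw [Finset.prod_range_succ', Nat.factorial_succ, h3]
  push_cast
  field_simp
  ring

lemma gb_choose (r m : ℕ) (x : ℚ) :
    (Nat.choose (m + r) r : ℚ) * genBinom x (m + r) = genBinom x r * genBinom (x - r) m := by
  induction m with
  | zero => simp [gb_zero]
  | succ m ih =>
    have h1 : ((m : ℚ) + 1) ≠ 0 := by positivity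
    have h2 : ((m : ℚ) + r + 1) ≠ 0 := by positivity
    have hc : (Nat.choose (m + 1 + r) r : ℚ) * (m + 1) = Nat.choose (m + r) r * (m + r + 1) := by
      have h := Nat.choose_mul_succ_eq (m + r) r
      have e : m + r + 1 - r = m + 1 := by omega
      rw [e] at h
      have e2 : m + 1 + r = m + r + 1 := by omega
      rw [e2]
      exact_mod_cast h.symm
    have ha := gb_succ x (m + r)
    have hb := gb_succ (x - r) m
    have e2 : m + 1 + r = m + r + 1 := by omega
    rw [e2] at hc ⊢
    push_cast at ha
    apply mul_left_cancel₀ h1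
    linear_combination genBinom x (m + r + 1) * hc + (Nat.choose (m + r) r : ℚ) * ha
      - genBinom x r * hb + (x - r - m) * ih

lemma weighted_left (x y : ℚ) (k : ℕ) :
    ∑ p ∈ antidiagonal (k + 1), (p.1 : ℚ) * (genBinom x p.1 * genBinom y p.2)
      = x * ∑ p ∈ antidiagonal k, genBinom (x - 1) p.1 * genBinom y p.2 := by
  rw [Finset.Nat.sum_antidiagonal_succ, Finset.mul_sum]
  simp only [Nat.cast_zero, zero_mul, zero_add]
  apply Finset.sum_congr rfl
  intro p _
  push_cast
  linear_combination genBinom y p.2 * gb_succ_left x p.1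

lemma weighted_right (x y : ℚ) (k : ℕ) :
    ∑ p ∈ antidiagonal (k + 1), (p.2 : ℚ) * (genBinom x p.1 * genBinom y p.2)
      = y * ∑ p ∈ antidiagonal k, genBinom x p.1 * genBinom (y - 1) p.2 := by
  rw [Finset.Nat.sum_antidiagonal_succ', Finset.mul_sum]
  simp only [Nat.cast_zero, zero_mul, zero_add]
  apply Finset.sum_congr rfl
  intro p _
  push_cast
  linear_combination genBinom x p.1 * gb_succ_left y p.2

lemma gb_vandermonde (k : ℕ) : ∀ x y : ℚ,
    ∑ p ∈ antidiagonal k, genBinom x p.1 * genBinom y p.2 = genBinom (x + y) k := by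
  induction k with
  | zero => intro x y; simp [gb_zero]
  | succ k ih =>
    intro x y
    have h1 : ((k : ℚ) + 1) ≠ 0 := by positivity
    apply mul_left_cancel₀ h1
    have hs : ((k : ℚ) + 1) * ∑ p ∈ antidiagonal (k + 1), genBinom x p.1 * genBinom y p.2
        = ∑ p ∈ antidiagonal (k + 1), (p.1 : ℚ) * (genBinom x p.1 * genBinom y p.2)
        + ∑ p ∈ antidiagonal (k + 1), (p.2 : ℚ) * (genBinom x p.1 * genBinom y p.2) := by
      rw [Finset.mul_sum, ← Finset.sum_add_distrib]
      apply Finset.sum_congr rfl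
      intro p hp
      have h : (p.1 : ℚ) + p.2 = k + 1 := by exact_mod_cast mem_antidiagonal.mp hp
      rw [← h]
      ring
    rw [hs, weighted_left, weighted_right, ih, ih, gb_succ_left]
    have e1 : x - 1 + y = x + y - 1 := by ring
    have e2 : x + (y - 1) = x + y - 1 := by ring
    rw [e1, e2]
    ring

/-- The signed Vandermonde-type sum; the shift `x - y = t - r` is built in. -/
lemma weighted_diff (r t x y : ℚ) (hxy : x - y = t - r) (k : ℕ) :
    (x + y) * ∑ p ∈ antidiagonal k, (p.1 + r - (p.2 + t)) * (genBinom x p.1 * genBinom y p.2)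
      = (r - t) * (x + y - k) * genBinom (x + y) k := by
  have hs : ∑ p ∈ antidiagonal k, (p.1 + r - (p.2 + t)) * (genBinom x p.1 * genBinom y p.2)
      = ∑ p ∈ antidiagonal k, (p.1 : ℚ) * (genBinom x p.1 * genBinom y p.2)
      - ∑ p ∈ antidiagonal k, (p.2 : ℚ) * (genBinom x p.1 * genBinom y p.2)
      + (r - t) * ∑ p ∈ antidiagonal k, genBinom x p.1 * genBinom y p.2 := by
    rw [Finset.mul_sum, ← Finset.sum_sub_distrib, ← Finset.sum_add_distrib]
    apply Finset.sum_congr rfl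
    intro p _
    ring
  cases k with
  | zero => simp [gb_zero]; ring
  | succ k =>
    have e1 : x - 1 + y = x + y - 1 := by ring
    have e2 : x + (y - 1) = x + y - 1 := by ring
    rw [hs, weighted_left, weighted_right, gb_vandermonde, gb_vandermonde, gb_vandermonde, e1, e2]
    have h := gb_succ_left (x + y) k
    push_cast
    linear_combination (x + y) * genBinom (x + y - 1) k * hxy + (r - t) * h

/-- For all `r, t, k ∈ ℕ`:
`∑_{m=0}^{k} binom(m+r, r)·binom(k−m+t, t)·C_{m+r, k−m+t} = binom(−r−t−1, k)·C_{r,t}`. -/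
theorem sum_choose_mul_Cmn (r t k : ℕ) :
    ∑ m ∈ Finset.range (k + 1),
      (Nat.choose (m + r) r : ℚ) * (Nat.choose (k - m + t) t : ℚ) * Cmn (m + r) (k - m + t)
    = genBinom (-(r : ℚ) - t - 1) k * Cmn r t := by
  have hk : (r : ℚ) + t + k + 1 ≠ 0 := by positivity
  have hrt : (r : ℚ) + t + 1 ≠ 0 := by positivity
  rw [← Finset.Nat.sum_antidiagonal_eq_sum_range_succ
    (fun i j => (Nat.choose (i + r) r : ℚ) * (Nat.choose (j + t) t : ℚ) * Cmn (i + r) (j + t)) k]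
  have h := weighted_diff r t (-(1 / 2) - r) (-(1 / 2) - t) (by ring) k
  have e : (-(1 / 2) - (r : ℚ)) + (-(1 / 2) - t) = -(r : ℚ) - t - 1 := by ring
  rw [e] at h
  have hs : ∑ p ∈ antidiagonal k,
      (Nat.choose (p.1 + r) r : ℚ) * (Nat.choose (p.2 + t) t : ℚ) * Cmn (p.1 + r) (p.2 + t)
      = (1 / 2) / ((r : ℚ) + t + k + 1) * genBinom (-(1 / 2)) r * genBinom (-(1 / 2)) t *
        ∑ p ∈ antidiagonal k, ((p.1 : ℚ) + r - (p.2 + t)) *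
          (genBinom (-(1 / 2) - r) p.1 * genBinom (-(1 / 2) - t) p.2) := by
    rw [Finset.mul_sum]
    apply Finset.sum_congr rfl
    intro p hp
    have hp' : (p.1 : ℚ) + p.2 = k := by exact_mod_cast mem_antidiagonal.mp hp
    have h1 := gb_choose r p.1 (-(1 / 2))
    have h2 := gb_choose t p.2 (-(1 / 2))
    have e3 : ((p.1 + r : ℕ) : ℚ) + ((p.2 + t : ℕ) : ℚ) + 1 = r + t + k + 1 := by
      rw [← hp']; push_cast; ring
    unfold Cmn
    rw [e3]
    push_cast
    calc _ = (1 / 2) / ((r : ℚ) + t + k + 1) * ((p.1 : ℚ) + r - (p.2 + t)) *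
          ((Nat.choose (p.1 + r) r : ℚ) * genBinom (-(1 / 2)) (p.1 + r)) *
          ((Nat.choose (p.2 + t) t : ℚ) * genBinom (-(1 / 2)) (p.2 + t)) := by ring
      _ = _ := by rw [h1, h2]; ring
  rw [hs]
  unfold Cmn
  generalize ∑ p ∈ antidiagonal k, ((p.1 : ℚ) + r - (p.2 + t)) *
          (genBinom (-(1 / 2) - r) p.1 * genBinom (-(1 / 2) - t) p.2) = S at h ⊢
  have hS : S = ((r : ℚ) - t) * (r + t + k + 1) * genBinom (-(r : ℚ) - t - 1) k / (r + t + 1) := by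
    rw [eq_div_iff hrt]
    linear_combination -h
  rw [hS]
  field_simp
end
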